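/- Let f(u) = e^u (so K = 1). Then there exist a constant c > 0 and α₀ such that for all α ≥ α₀: (i) |λ*(α) · log α / (2α) − 1| ≤ c/√(log α), i.e. λ*(α) = (2α/log α)(1 + O(1/√(log α))); (ii) every semistable solution u of problem (P_{α,λ*(α)}) satisfies (1/2) log(log α) − c ≤ u(0) ≤ c log(log α), i.e. u(0) = O(log log α). -/

import Mathlib

open Set MeasureTheory Filter

/-- The standing data and assumptions of the Gelfand-type problem for
auto-ignition of a free round turbulent jet:
`f : [0,∞) → (0,∞)` is `C¹`, convex, non-decreasing with `K = ∫₀^∞ ds / f s < ∞`;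
`φ, ψ : [0,1] → [0,∞)` are non-increasing Lipschitz with `φ 0 = ψ 0 = 1`,
`φ > 0` on `[0,1)`, and `M s = max_{r ∈ [0,s]} ψ r / φ r` is integrable on `(0,1)`. -/
structure GelfandData where
  f : ℝ → ℝ
  phi : ℝ → ℝ
  psi : ℝ → ℝ
  M : ℝ → ℝ
  K : ℝ
  f_pos : ∀ s, 0 ≤ s → 0 < f s
  f_smooth : ContDiffOn ℝ 1 f (Ici 0)
  f_convex : ConvexOn ℝ (Ici 0) f
  f_mono : MonotoneOn f (Ici 0)
  f_int : IntegrableOn (fun s => 1 / f s) (Ioi 0)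
  K_def : K = ∫ s in Ioi (0:ℝ), 1 / f s
  phi_nonneg : ∀ r ∈ Icc (0:ℝ) 1, 0 ≤ phi r
  psi_nonneg : ∀ r ∈ Icc (0:ℝ) 1, 0 ≤ psi r
  phi_anti : AntitoneOn phi (Icc 0 1)
  psi_anti : AntitoneOn psi (Icc 0 1)
  phi_lip : ∃ L, LipschitzOnWith L phi (Icc 0 1)
  psi_lip : ∃ L, LipschitzOnWith L psi (Icc 0 1)
  phi_zero : phi 0 = 1
  psi_zero : psi 0 = 1
  phi_pos : ∀ r ∈ Ico (0:ℝ) 1, 0 < phi r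
  M_def : ∀ s ∈ Ico (0:ℝ) 1, IsGreatest ((fun r => psi r / phi r) '' Icc 0 s) (M s)
  M_int : IntegrableOn M (Ioo 0 1)

/-- `u` is a (classical, radial) solution of problem `(P_{α,λ})`:
`u ∈ C²((0,1)) ∩ C¹([0,1])`, `u > 0` on `[0,1)`, `u'(0) = 0`, `u 1 = 0`, and
`-u'' - (1/r + α r φ(r)) u' = λ ψ(r) f(u(r))` on `(0,1)`. -/
def IsSolution (D : GelfandData) (α lam : ℝ) (u : ℝ → ℝ) : Prop :=
  ContDiffOn ℝ 1 u (Icc 0 1) ∧ ContDiffOn ℝ 2 u (Ioo 0 1) ∧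
  (∀ r ∈ Ico (0:ℝ) 1, 0 < u r) ∧
  derivWithin u (Icc 0 1) 0 = 0 ∧ u 1 = 0 ∧
  ∀ r ∈ Ioo (0:ℝ) 1,
    -(derivWithin (derivWithin u (Icc 0 1)) (Ioo 0 1) r)
      - (1 / r + α * r * D.phi r) * derivWithin u (Icc 0 1) r
      = lam * D.psi r * D.f (u r)

/-- The set of `λ > 0` for which problem `(P_{α,λ})` admits a solution. -/
def solvableSet (D : GelfandData) (α : ℝ) : Set ℝ :=
  {lam | 0 < lam ∧ ∃ u, IsSolution D α lam u}

/-- The extremal Frank-Kamenetskii parameter `λ*(α)`. -/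
noncomputable def lamStar (D : GelfandData) (α : ℝ) : ℝ := sSup (solvableSet D α)

/-- The weight `μ(r) = exp(α ∫₀^r s φ(s) ds)`. -/
noncomputable def muW (D : GelfandData) (α r : ℝ) : ℝ :=
  Real.exp (α * ∫ s in (0:ℝ)..r, s * D.phi s)

/-- `u` is a semistable solution: for every `C¹` test function `η` with `η 1 = 0`,
`∫₀¹ η'^2 μ r dr ≥ λ ∫₀¹ ψ f'(u) η² μ r dr`. -/
def IsSemistable (D : GelfandData) (α lam : ℝ) (u : ℝ → ℝ) : Prop :=
  ∀ η : ℝ → ℝ, ContDiff ℝ 1 η → η 1 = 0 →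
    lam * ∫ r in Ioo (0:ℝ) 1,
        D.psi r * derivWithin D.f (Ici 0) (u r) * (η r) ^ 2 * muW D α r * r
      ≤ ∫ r in Ioo (0:ℝ) 1, (deriv η r) ^ 2 * muW D α r * r

noncomputable section

def gMu (φ : ℝ → ℝ) (α r : ℝ) : ℝ := Real.exp (α * ∫ s in (0:ℝ)..r, s * φ s)

structure Cl (φ ψ : ℝ → ℝ) (L : ℝ) : Prop where
  cφ : Continuous φ
  cψ : Continuous ψ
  φ0 : ∀ r, 0 ≤ φ r
  φ1 : ∀ r, φ r ≤ 1
  ψ0 : ∀ r, 0 ≤ ψ r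
  ψ1 : ∀ r, ψ r ≤ 1
  hL : 1 ≤ L
  φL : ∀ r ∈ Icc (0:ℝ) 1, 1 - L * r ≤ φ r
  ψL : ∀ r ∈ Icc (0:ℝ) 1, 1 - L * r ≤ ψ r

theorem gMu_pos (φ : ℝ → ℝ) (α r : ℝ) : 0 < gMu φ α r := Real.exp_pos _

theorem gMu_zero (φ : ℝ → ℝ) (α : ℝ) : gMu φ α 0 = 1 := by simp [gMu]

theorem gMu_deriv {φ : ℝ → ℝ} (hφ : Continuous φ) (α r : ℝ) :
    HasDerivAt (gMu φ α) (gMu φ α r * (α * (r * φ r))) r := by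
  have hc : Continuous (fun s : ℝ => s * φ s) := continuous_id.mul hφ
  have h := intervalIntegral.integral_hasDerivAt_right (hc.intervalIntegrable 0 r)
    (hc.stronglyMeasurableAtFilter _ _) hc.continuousAt
  exact (h.const_mul α).exp

theorem gMu_cont {φ : ℝ → ℝ} (hφ : Continuous φ) (α : ℝ) : Continuous (gMu φ α) :=
  continuous_iff_continuousAt.2 fun r => (gMu_deriv hφ α r).continuousAt

theorem gMu_mono {φ : ℝ → ℝ} (hφ : Continuous φ) (h0 : ∀ r, 0 ≤ φ r) {α : ℝ} (hα : 0 ≤ α) :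
    MonotoneOn (gMu φ α) (Ici 0) := by
  apply monotoneOn_of_deriv_nonneg (convex_Ici 0) (gMu_cont hφ α).continuousOn
  · intro x _
    exact (gMu_deriv hφ α x).differentiableAt.differentiableWithinAt
  · intro x hx
    rw [interior_Ici] at hx
    rw [(gMu_deriv hφ α x).deriv]
    exact mul_nonneg (gMu_pos _ _ _).le (mul_nonneg hα (mul_nonneg (le_of_lt hx) (h0 x)))

theorem gMu_one_le {φ : ℝ → ℝ} (hφ : Continuous φ) (h0 : ∀ r, 0 ≤ φ r) {α r : ℝ} (hα : 0 ≤ α)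
    (hr : 0 ≤ r) : 1 ≤ gMu φ α r := by
  have := gMu_mono hφ h0 hα (show (0:ℝ) ∈ Ici 0 by simp) (show r ∈ Ici 0 from hr) hr
  rwa [gMu_zero] at this

/-- comparison from derivatives -/
theorem mono_cmp {f g f' g' : ℝ → ℝ} {a b : ℝ} (hab : a ≤ b)
    (hf : ContinuousOn f (Icc a b)) (hg : ContinuousOn g (Icc a b))
    (hf' : ∀ x ∈ Ioo a b, HasDerivAt f (f' x) x) (hg' : ∀ x ∈ Ioo a b, HasDerivAt g (g' x) x)
    (h : ∀ x ∈ Ioo a b, f' x ≤ g' x) : f b - f a ≤ g b - g a := by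
  have hm : MonotoneOn (fun x => g x - f x) (Icc a b) := by
    apply monotoneOn_of_deriv_nonneg (convex_Icc a b) (hg.sub hf)
    · intro x hx
      rw [interior_Icc] at hx
      exact ((hg' x hx).sub (hf' x hx)).differentiableAt.differentiableWithinAt
    · intro x hx
      rw [interior_Icc] at hx
      have := ((hg' x hx).sub (hf' x hx)).deriv
      have h2 := h x hx
      change 0 ≤ deriv (g - f) x
      rw [this]; linarith
  have := hm (left_mem_Icc.2 hab) (right_mem_Icc.2 hab) hab
  simp only at this
  linarith

theorem gMu_lower {φ ψ : ℝ → ℝ} {L : ℝ} (C : Cl φ ψ L) {α r : ℝ} (hα : 0 ≤ α)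
    (hr : 0 ≤ r) (hrL : r ≤ 1 / (2 * L)) : 1 + α * r ^ 2 / 4 ≤ gMu φ α r := by
  have hL := C.hL
  have hr1 : 1 / (2 * L) ≤ 1 := by rw [div_le_one (by linarith)]; linarith
  have key := mono_cmp (f := fun r => α * r ^ 2 / 4) (g := gMu φ α)
    (f' := fun r => α * r / 2) (g' := fun r => gMu φ α r * (α * (r * φ r))) hr
    (by fun_prop) (gMu_cont C.cφ α).continuousOn
    (fun x _ => by
      have := ((hasDerivAt_pow 2 x).const_mul α).div_const 4
      exact this.congr_deriv (by norm_num; ring))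
    (fun x _ => gMu_deriv C.cφ α x)
    (fun x hx => by
      have h1 : 1 - L * x ≤ φ x := C.φL x ⟨hx.1.le, by linarith [hx.2]⟩
      have h2 : L * x ≤ 1 / 2 := by
        have : x ≤ 1 / (2 * L) := by linarith [hx.2]
        calc L * x ≤ L * (1 / (2 * L)) := by gcongr
          _ = 1 / 2 := by field_simp
      have h3 := gMu_one_le C.cφ C.φ0 hα hx.1.le
      have h4 : 0 ≤ α * x := mul_nonneg hα hx.1.le
      have h5 : α * x / 2 ≤ α * (x * φ x) := by nlinarith
      have h6 : 0 ≤ α * (x * φ x) := by linarith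
      nlinarith)
  simp only [gMu_zero] at key
  linarith

theorem gMu_upper {φ ψ : ℝ → ℝ} {L : ℝ} (C : Cl φ ψ L) {α r : ℝ} (hα : 0 ≤ α)
    (hr : 0 ≤ r) : gMu φ α r ≤ Real.exp (α * r ^ 2 / 2) := by
  unfold gMu
  have key := mono_cmp (f := fun r => ∫ s in (0:ℝ)..r, s * φ s) (g := fun r => r ^ 2 / 2)
    (f' := fun r => r * φ r) (g' := fun r => r) hr
    (continuous_iff_continuousAt.2 fun r => (by
      have hc : Continuous (fun s : ℝ => s * φ s) := continuous_id.mul C.cφ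
      exact (intervalIntegral.integral_hasDerivAt_right (hc.intervalIntegrable 0 r)
        (hc.stronglyMeasurableAtFilter _ _) hc.continuousAt).continuousAt)).continuousOn
    (by fun_prop)
    (fun x _ => by
      have hc : Continuous (fun s : ℝ => s * φ s) := continuous_id.mul C.cφ
      exact (intervalIntegral.integral_hasDerivAt_right (hc.intervalIntegrable 0 x)
        (hc.stronglyMeasurableAtFilter _ _) hc.continuousAt))
    (fun x _ => by
      have := (hasDerivAt_pow 2 x).div_const 2
      exact this.congr_deriv (by norm_num))
    (fun x hx => by have := C.φ1 x; nlinarith [hx.1])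
  simp only [intervalIntegral.integral_same] at key
  apply Real.exp_le_exp.2
  calc α * _ ≤ α * (r ^ 2 / 2) := by gcongr; linarith
    _ = _ := by ring

/-- clean solution -/
structure CSol (φ ψ : ℝ → ℝ) (α lam : ℝ) (U V : ℝ → ℝ) : Prop where
  cU : Continuous U
  cV : Continuous V
  dU : ∀ r ∈ Ioo (0:ℝ) 1, HasDerivAt U (V r) r
  eqn : ∀ r ∈ Icc (0:ℝ) 1, r * gMu φ α r * V r
    = - (lam * ∫ s in (0:ℝ)..r, s * gMu φ α s * ψ s * Real.exp (U s))
  pos : ∀ r ∈ Ico (0:ℝ) 1, 0 < U r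
  one : U 1 = 0

theorem flux_cont {φ ψ : ℝ → ℝ} {L : ℝ} (C : Cl φ ψ L) (α : ℝ) {U : ℝ → ℝ} (hU : Continuous U) :
    Continuous (fun s => s * gMu φ α s * ψ s * Real.exp (U s)) :=
  ((continuous_id.mul (gMu_cont C.cφ α)).mul C.cψ).mul (Real.continuous_exp.comp hU)

theorem prim_deriv {h : ℝ → ℝ} (hc : Continuous h) (r : ℝ) :
    HasDerivAt (fun r => ∫ s in (0:ℝ)..r, h s) (h r) r :=
  intervalIntegral.integral_hasDerivAt_right (hc.intervalIntegrable 0 r)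
    (hc.stronglyMeasurableAtFilter _ _) hc.continuousAt

theorem prim_cont {h : ℝ → ℝ} (hc : Continuous h) :
    Continuous (fun r => ∫ s in (0:ℝ)..r, h s) :=
  continuous_iff_continuousAt.2 fun r => (prim_deriv hc r).continuousAt

theorem CSol.V_nonpos {φ ψ : ℝ → ℝ} {L α lam : ℝ} {U V : ℝ → ℝ} (C : Cl φ ψ L)
    (hl : 0 ≤ lam) (S : CSol φ ψ α lam U V) {r : ℝ} (hr : r ∈ Ioo (0:ℝ) 1) : V r ≤ 0 := by
  have h1 := S.eqn r ⟨hr.1.le, hr.2.le⟩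
  have h2 : 0 ≤ ∫ s in (0:ℝ)..r, s * gMu φ α s * ψ s * Real.exp (U s) := by
    apply intervalIntegral.integral_nonneg hr.1.le
    intro s hs
    have := C.ψ0 s
    have := gMu_pos φ α s
    have := hs.1
    positivity
  have h3 : 0 < r * gMu φ α r := mul_pos hr.1 (gMu_pos _ _ _)
  have h4 := mul_nonneg hl h2
  by_contra hV
  push Not at hV
  have := mul_pos h3 hV
  linarith

theorem CSol.anti {φ ψ : ℝ → ℝ} {L α lam : ℝ} {U V : ℝ → ℝ} (C : Cl φ ψ L)
    (hl : 0 ≤ lam) (S : CSol φ ψ α lam U V) : AntitoneOn U (Icc 0 1) := by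
  apply antitoneOn_of_deriv_nonpos (convex_Icc 0 1) S.cU.continuousOn
  · intro x hx
    rw [interior_Icc] at hx
    exact (S.dU x hx).differentiableAt.differentiableWithinAt
  · intro x hx
    rw [interior_Icc] at hx
    rw [(S.dU x hx).deriv]
    exact S.V_nonpos C hl hx

theorem half_bd {L : ℝ} (hL : 1 ≤ L) : 1 / (2 * L) ≤ 1 / 2 := by
  rw [div_le_div_iff₀ (by linarith) (by norm_num)]; linarith

theorem Lx_half {L x : ℝ} (hL : 1 ≤ L) (h : x ≤ 1 / (2 * L)) : L * x ≤ 1 / 2 :=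
  calc L * x ≤ L * (1 / (2 * L)) := by gcongr
      _ = 1 / 2 := by field_simp

/-- Main upper estimate (A). -/
theorem CSol.estA {φ ψ : ℝ → ℝ} {L α lam : ℝ} {U V : ℝ → ℝ} (C : Cl φ ψ L)
    (hα : 0 < α) (hl : 0 ≤ lam) (S : CSol φ ψ α lam U V) :
    lam / (2 * α) * (Real.log α - (2 * Real.log (4 * L) + 1)) ≤ 1 - Real.exp (- U 0) := by
  have hL := C.hL
  set δ := 1 / (2 * L) with hδ
  have hδ0 : 0 < δ := by positivity
  have hδ2 : δ ≤ 1 / 2 := half_bd hL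
  have key := mono_cmp
    (f := fun r => lam / α * (1 / 2 * Real.log (4 + α * r ^ 2) - L * r))
    (g := fun r => Real.exp (- U r))
    (f' := fun r => lam / α * (1 / 2 * (α * (2 * r) / (4 + α * r ^ 2)) - L))
    (g' := fun r => Real.exp (- U r) * (- V r)) hδ0.le
    (by
      apply Continuous.continuousOn
      apply continuous_const.mul
      apply Continuous.sub _ (by fun_prop)
      apply continuous_const.mul
      apply Continuous.log (by fun_prop)
      intro x; positivity)
    (by have := S.cU; fun_prop)
    (fun x _ => by
      have h1 : HasDerivAt (fun r : ℝ => 4 + α * r ^ 2) (α * (2 * x)) x := by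
        have := ((hasDerivAt_pow 2 x).const_mul α).const_add 4
        exact this.congr_deriv (by norm_num)
      have h2 := (((h1.log (by positivity)).const_mul (1/2)).sub
        ((hasDerivAt_id x).const_mul L)).const_mul (lam / α)
      exact h2.congr_deriv (by simp))
    (fun x hx => (S.dU x ⟨hx.1, by linarith [hx.2]⟩).neg.exp)
    (fun x hx => by
      have hx1 : x < 1 := by linarith [hx.2]
      have hx0 := hx.1
      have hm := gMu_pos φ α x
      have hLx := Lx_half hL hx.2.le
      have hml := gMu_lower C hα.le hx0.le hx.2.le
      -- lower bound on flux
      have hJ := mono_cmp (f := fun t => Real.exp (U x) * (1 - L * x) / α * gMu φ α t)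
        (g := fun t => ∫ s in (0:ℝ)..t, s * gMu φ α s * ψ s * Real.exp (U s))
        (f' := fun t => Real.exp (U x) * (1 - L * x) / α * (gMu φ α t * (α * (t * φ t))))
        (g' := fun t => t * gMu φ α t * ψ t * Real.exp (U t)) hx0.le
        ((gMu_cont C.cφ α).const_mul _).continuousOn
        (prim_cont (flux_cont C α S.cU)).continuousOn
        (fun t _ => (gMu_deriv C.cφ α t).const_mul _)
        (fun t _ => prim_deriv (flux_cont C α S.cU) t)
        (fun t ht => by
          have a1 : U x ≤ U t := S.anti C hl ⟨ht.1.le, by linarith [ht.2]⟩ ⟨hx0.le, hx1.le⟩ ht.2.le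
          have a2 : 1 - L * t ≤ ψ t := C.ψL t ⟨ht.1.le, by linarith [ht.2]⟩
          have a3 : L * t ≤ L * x := by have := ht.2.le; gcongr
          have a4 := C.φ1 t
          have a5 := C.φ0 t
          have a6 := gMu_pos φ α t
          have a7 := ht.1
          have a8 := Real.exp_le_exp.2 a1
          calc _ = t * gMu φ α t * ((1 - L * x) * φ t) * Real.exp (U x) := by
                field_simp
            _ ≤ t * gMu φ α t * ψ t * Real.exp (U t) := by
                have b : (1 - L * x) * φ t ≤ ψ t := by nlinarith
                have b0 : 0 ≤ (1 - L * x) * φ t := mul_nonneg (by linarith) a5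
                have := C.ψ0 t
                gcongr)
      simp only [gMu_zero, intervalIntegral.integral_same] at hJ
      have hE := S.eqn x ⟨hx0.le, hx1.le⟩
      set J := ∫ s in (0:ℝ)..x, s * gMu φ α s * ψ s * Real.exp (U s)
      set m := gMu φ α x
      have hV : - V x = lam * J / (x * m) := by
        rw [eq_div_iff (by positivity)]; linarith
      have hJ' : Real.exp (U x) * (1 - L * x) / α * (m - 1) ≤ J := by linarith
      have h5 : lam / α * ((1 - L * x) * (m - 1) / (x * m)) ≤ Real.exp (- U x) * (- V x) := by
        rw [hV]
        calc _ = Real.exp (- U x) * (lam * (Real.exp (U x) * (1 - L * x) / α * (m - 1)) / (x * m)) := by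
              rw [Real.exp_neg]; field_simp
          _ ≤ _ := by gcongr
      refine le_trans ?_ h5
      apply mul_le_mul_of_nonneg_left _ (by positivity)
      have h6 : α * x ^ 2 / (4 + α * x ^ 2) ≤ (m - 1) / m := by
        rw [div_le_div_iff₀ (by positivity) hm]
        nlinarith
      have h7 : α * x ^ 2 / (4 + α * x ^ 2) ≤ 1 := by
        rw [div_le_one (by positivity)]; linarith
      calc 1 / 2 * (α * (2 * x) / (4 + α * x ^ 2)) - L
          ≤ (1 - L * x) / x * (α * x ^ 2 / (4 + α * x ^ 2)) := by
            have : (1 - L * x) / x * (α * x ^ 2 / (4 + α * x ^ 2)) =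
              1 / 2 * (α * (2 * x) / (4 + α * x ^ 2)) - L * (α * x ^ 2 / (4 + α * x ^ 2)) := by
              field_simp
            rw [this]; nlinarith
        _ ≤ (1 - L * x) / x * ((m - 1) / m) := by
            apply mul_le_mul_of_nonneg_left h6
            apply div_nonneg (by linarith) hx0.le
        _ = _ := by field_simp)
  have hUδ : 0 < U δ := S.pos δ ⟨hδ0.le, by linarith⟩
  have hU1 : Real.exp (- U δ) ≤ 1 := by rw [Real.exp_le_one_iff]; linarith
  have hlog : Real.log α - 2 * Real.log (2 * L) ≤ Real.log (4 + α * δ ^ 2) := by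
    have e : Real.log α - 2 * Real.log (2 * L) = Real.log (α * δ ^ 2) := by
      rw [Real.log_mul (x := α) (y := δ ^ 2) (by positivity) (by positivity), Real.log_pow, hδ, one_div, Real.log_inv]
      push_cast; ring
    rw [e]
    apply Real.log_le_log (by positivity); linarith
  have hl4 : Real.log (4 * L) = Real.log 2 + Real.log (2 * L) := by
    rw [← Real.log_mul (by norm_num) (by positivity)]; ring_nf
  have hl5 : Real.log 4 = 2 * Real.log 2 := by
    rw [show (4:ℝ) = 2 ^ 2 by norm_num, Real.log_pow]; norm_num
  have hLδ : L * δ = 1 / 2 := by rw [hδ]; field_simp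
  have h0 : Real.log (4 + α * 0 ^ 2) = 2 * Real.log 2 := by simpa using hl5
  rw [h0, hLδ] at key
  have hla : 0 ≤ lam / α := by positivity
  calc _ = lam / α * (1 / 2 * (Real.log α - 2 * Real.log (2 * L)) - 1 / 2 - Real.log 2) := by
        rw [hl4]; field_simp; ring
    _ ≤ lam / α * (1 / 2 * Real.log (4 + α * δ ^ 2) - 1 / 2 - Real.log 2) := by gcongr
    _ ≤ _ := by linarith

theorem maxsq_deriv (y : ℝ) : HasDerivAt (fun y : ℝ => (max 0 y) ^ 2) (2 * max 0 y) y := by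
  rcases lt_trichotomy y 0 with h | h | h
  · have : (fun y : ℝ => (max 0 y) ^ 2) =ᶠ[nhds y] fun _ => 0 := by
      filter_upwards [eventually_lt_nhds h] with z hz
      simp [max_eq_left hz.le]
    rw [max_eq_left h.le]
    exact ((hasDerivAt_const y (0:ℝ)).congr_of_eventuallyEq this).congr_deriv (by simp)
  · subst h
    rw [hasDerivAt_iff_isLittleO]
    have h1 : (fun x : ℝ => x ^ 2) =o[nhds 0] fun x => x :=
      Asymptotics.isLittleO_pow_id (by norm_num)
    simp only [max_self, sub_zero, mul_zero, smul_zero]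
    refine Asymptotics.IsBigO.trans_isLittleO ?_ h1
    apply Asymptotics.IsBigO.of_bound 1
    filter_upwards with x
    rcases le_total x 0 with h | h
    · simp [max_eq_left h]; positivity
    · simp [max_eq_right h]
  · have : (fun y : ℝ => (max 0 y) ^ 2) =ᶠ[nhds y] fun y => y ^ 2 := by
      filter_upwards [eventually_gt_nhds h] with z hz
      simp [max_eq_right hz.le]
    rw [max_eq_right h.le]
    exact ((hasDerivAt_pow 2 y).congr_of_eventuallyEq this).congr_deriv (by simp)

def etaT (α r : ℝ) : ℝ := (max 0 (1 - 8 * α * r ^ 2)) ^ 2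

theorem etaT_deriv (α r : ℝ) :
    HasDerivAt (etaT α) (2 * max 0 (1 - 8 * α * r ^ 2) * (-(16 * α * r))) r := by
  have h1 : HasDerivAt (fun r : ℝ => 1 - 8 * α * r ^ 2) (-(16 * α * r)) r := by
    have := ((hasDerivAt_pow 2 r).const_mul (8 * α)).const_sub 1
    exact this.congr_deriv (by norm_num; ring)
  exact (maxsq_deriv (1 - 8 * α * r ^ 2)).comp r h1

theorem etaT_contDiff (α : ℝ) : ContDiff ℝ 1 (etaT α) := by
  rw [contDiff_one_iff_deriv]
  refine ⟨fun r => (etaT_deriv α r).differentiableAt, ?_⟩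
  have : deriv (etaT α) = fun r => 2 * max 0 (1 - 8 * α * r ^ 2) * (-(16 * α * r)) :=
    funext fun r => (etaT_deriv α r).deriv
  rw [this]
  fun_prop

theorem CSol.fluxD {φ ψ : ℝ → ℝ} {L α lam : ℝ} {U V : ℝ → ℝ} (C : Cl φ ψ L)
    (hα : 1 ≤ α) (hl : 0 < lam) (S : CSol φ ψ α lam U V)
    (HS : ∀ η : ℝ → ℝ, ContDiff ℝ 1 η → η 1 = 0 →
      lam * ∫ r in (0:ℝ)..1, ψ r * Real.exp (U r) * (η r) ^ 2 * gMu φ α r * r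
      ≤ ∫ r in (0:ℝ)..1, (deriv η r) ^ 2 * gMu φ α r * r)
    {a : ℝ} (ha0 : 0 < a) (ha : 128 * α * a ^ 2 = 1) :
    lam * (∫ s in (0:ℝ)..a, s * gMu φ α s * ψ s * Real.exp (U s)) ≤ 1 := by
  have hst := HS (etaT α) (etaT_contDiff α) (by
    unfold etaT; rw [max_eq_left (by linarith)]; norm_num)
  have ha1 : 4 * a ≤ 1 := by nlinarith
  have hcm := gMu_cont C.cφ α
  have hcU := S.cU
  have hcψ := C.cψ
  have hcη : Continuous (etaT α) := (etaT_contDiff α).continuous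
  have hcη' : Continuous (deriv (etaT α)) := (etaT_contDiff α).continuous_deriv le_rfl
  have hc1 : Continuous fun r => (deriv (etaT α) r) ^ 2 * gMu φ α r * r := by fun_prop
  have hc2 : Continuous fun r => ψ r * Real.exp (U r) * (etaT α r) ^ 2 * gMu φ α r * r := by
    fun_prop
  -- energy on [0, 4a]
  have e1 := mono_cmp (a := 0) (b := 4 * a)
    (f := fun t => ∫ r in (0:ℝ)..t, (deriv (etaT α) r) ^ 2 * gMu φ α r * r)
    (g := fun t => (16/15) * (8 * ((8 * α * t ^ 2) ^ 2 / 2 - 2 * (8 * α * t ^ 2) ^ 3 / 3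
      + (8 * α * t ^ 2) ^ 4 / 4)))
    (f' := fun r => (deriv (etaT α) r) ^ 2 * gMu φ α r * r)
    (g' := fun t => (16/15) * (8 * (8 * α * t ^ 2) * (1 - 8 * α * t ^ 2) ^ 2 * (16 * α * t)))
    (by linarith) (prim_cont hc1).continuousOn (by fun_prop) (fun x _ => prim_deriv hc1 x)
    (fun x _ => by
      have h1 : HasDerivAt (fun r : ℝ => 8 * α * r ^ 2) (16 * α * x) x := by
        have := ((hasDerivAt_pow 2 x).const_mul (8 * α))
        exact this.congr_deriv (by norm_num; ring)
      have h2 := ((((h1.pow 2).div_const 2).sub (((h1.pow 3).const_mul 2).div_const 3)).add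
        ((h1.pow 4).div_const 4)).const_mul 8
      exact (h2.const_mul (16/15)).congr_deriv (by norm_num; ring))
    (fun x hx => by
      have hx0 := hx.1
      have hx2 : 8 * α * x ^ 2 ≤ 1 := by
        have : x ^ 2 ≤ (4 * a) ^ 2 := by have := hx.2; gcongr
        nlinarith
      have hmu : gMu φ α x ≤ 16 / 15 := by
        refine (gMu_upper C (by linarith) hx0.le).trans ?_
        have h1 : Real.exp (α * x ^ 2 / 2) ≤ Real.exp (1/16) := by
          apply Real.exp_le_exp.2; linarith
        have h2 := Real.one_sub_le_exp_neg (1/16)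
        rw [Real.exp_neg] at h2
        have h3 := Real.exp_pos (1/16)
        have h4 : Real.exp (1/16) ≤ 16 / 15 := by
          rw [← inv_inv (Real.exp (1/16)), inv_le_comm₀ (by positivity) (by norm_num)]
          linarith
        linarith
      rw [(etaT_deriv α x).deriv, max_eq_right (by linarith)]
      have hp : 0 ≤ 8 * (8 * α * x ^ 2) * (1 - 8 * α * x ^ 2) ^ 2 * (16 * α * x) := by positivity
      calc _ = gMu φ α x * (8 * (8 * α * x ^ 2) * (1 - 8 * α * x ^ 2) ^ 2 * (16 * α * x)) := by ring
        _ ≤ _ := by gcongr)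
  have e2 := mono_cmp (a := 4 * a) (b := 1)
    (f := fun t => ∫ r in (0:ℝ)..t, (deriv (etaT α) r) ^ 2 * gMu φ α r * r)
    (g := fun t => (0:ℝ))
    (f' := fun r => (deriv (etaT α) r) ^ 2 * gMu φ α r * r)
    (g' := fun t => 0)
    ha1 (prim_cont hc1).continuousOn (by fun_prop) (fun x _ => prim_deriv hc1 x)
    (fun x _ => hasDerivAt_const _ _)
    (fun x hx => by
      have hx2 : 1 ≤ 8 * α * x ^ 2 := by
        have : (4 * a) ^ 2 ≤ x ^ 2 := by have := hx.1; gcongr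
        nlinarith
      rw [(etaT_deriv α x).deriv, max_eq_left (by linarith)]
      simp)
  have e3 := mono_cmp (a := 0) (b := a)
    (f := fun t => (15/16) ^ 4 * ∫ s in (0:ℝ)..t, s * gMu φ α s * ψ s * Real.exp (U s))
    (g := fun t => ∫ r in (0:ℝ)..t, ψ r * Real.exp (U r) * (etaT α r) ^ 2 * gMu φ α r * r)
    (f' := fun s => (15/16) ^ 4 * (s * gMu φ α s * ψ s * Real.exp (U s)))
    (g' := fun r => ψ r * Real.exp (U r) * (etaT α r) ^ 2 * gMu φ α r * r)
    ha0.le ((prim_cont (flux_cont C α hcU)).const_mul _).continuousOn (prim_cont hc2).continuousOn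
    (fun x _ => (prim_deriv (flux_cont C α hcU) x).const_mul _) (fun x _ => prim_deriv hc2 x)
    (fun x hx => by
      have hx0 := hx.1
      have hx2 : 8 * α * x ^ 2 ≤ 1 / 16 := by
        have : x ^ 2 ≤ a ^ 2 := by have := hx.2; gcongr
        nlinarith
      have hη : (15/16) ^ 4 ≤ (etaT α x) ^ 2 := by
        unfold etaT
        rw [max_eq_right (by linarith), ← pow_mul]
        have : (15/16:ℝ) ≤ 1 - 8 * α * x ^ 2 := by linarith
        gcongr
      have := C.ψ0 x
      have := gMu_pos φ α x
      calc _ = ψ x * Real.exp (U x) * (15/16) ^ 4 * gMu φ α x * x := by ring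
        _ ≤ _ := by gcongr)
  have e4 := mono_cmp (a := a) (b := 1)
    (f := fun t => (0:ℝ))
    (g := fun t => ∫ r in (0:ℝ)..t, ψ r * Real.exp (U r) * (etaT α r) ^ 2 * gMu φ α r * r)
    (f' := fun s => 0)
    (g' := fun r => ψ r * Real.exp (U r) * (etaT α r) ^ 2 * gMu φ α r * r)
    (by linarith) (by fun_prop) (prim_cont hc2).continuousOn
    (fun x _ => hasDerivAt_const _ _) (fun x _ => prim_deriv hc2 x)
    (fun x hx => by
      have hx0 : 0 < x := by linarith [hx.1]
      have := C.ψ0 x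
      have := gMu_pos φ α x
      positivity)
  simp only [intervalIntegral.integral_same] at e1 e3
  have hR : 8 * α * (4 * a) ^ 2 = 1 := by linarith
  rw [hR] at e1
  set I1 := ∫ r in (0:ℝ)..1, (deriv (etaT α) r) ^ 2 * gMu φ α r * r
  set I2 := ∫ r in (0:ℝ)..1, ψ r * Real.exp (U r) * (etaT α r) ^ 2 * gMu φ α r * r
  set J := ∫ s in (0:ℝ)..a, s * gMu φ α s * ψ s * Real.exp (U s)
  have f1 : I1 ≤ 16/15 * (2/3) := by norm_num at e1 e2; linarith
  have f2 : (15/16) ^ 4 * J ≤ I2 := by linarith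
  have f3 : lam * ((15/16) ^ 4 * J) ≤ lam * I2 := by gcongr
  nlinarith

theorem CSol.estD {φ ψ : ℝ → ℝ} {L α lam : ℝ} {U V : ℝ → ℝ} (C : Cl φ ψ L)
    (hα : L ^ 2 ≤ α) (hl : 0 < lam) (S : CSol φ ψ α lam U V)
    (HS : ∀ η : ℝ → ℝ, ContDiff ℝ 1 η → η 1 = 0 →
      lam * ∫ r in (0:ℝ)..1, ψ r * Real.exp (U r) * (η r) ^ 2 * gMu φ α r * r
      ≤ ∫ r in (0:ℝ)..1, (deriv η r) ^ 2 * gMu φ α r * r) :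
    U 0 ≤ Real.log (512 * α / lam) + 8 := by
  have hL := C.hL
  have hα1 : 1 ≤ α := by nlinarith
  obtain ⟨a, ha0, ha⟩ : ∃ a : ℝ, 0 < a ∧ 128 * α * a ^ 2 = 1 := by
    refine ⟨Real.sqrt (1 / (128 * α)), by positivity, ?_⟩
    rw [Real.sq_sqrt (by positivity)]; field_simp
  have hΦ := S.fluxD C hα1 hl HS ha0 ha
  have ha1 : a < 1 / 2 := by nlinarith
  have hLa : L * a ≤ 1 / 2 := by
    have : (L * a) ^ 2 ≤ (1/2) ^ 2 := by
      have : L ^ 2 * a ^ 2 ≤ α * a ^ 2 := by gcongr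
      rw [mul_pow]; linarith
    exact (abs_le_of_sq_le_sq' this (by norm_num)).2
  have hfc := flux_cont C α S.cU
  have hmua : gMu φ α a ≤ 2 := by
    refine (gMu_upper C (by linarith) ha0.le).trans ?_
    have h1 : Real.exp (α * a ^ 2 / 2) ≤ Real.exp (1/2) := by
      apply Real.exp_le_exp.2; linarith
    have h2 := Real.one_sub_le_exp_neg (1/2)
    rw [Real.exp_neg] at h2
    have h4 : Real.exp (1/2) ≤ 2 := by
      rw [← inv_inv (Real.exp (1/2)), inv_le_comm₀ (by positivity) (by norm_num)]
      linarith
    linarith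
  have hmu1 : ∀ x, 0 ≤ x → 1 ≤ gMu φ α x := fun x hx => gMu_one_le C.cφ C.φ0 (by linarith) hx
  have hmu2 : ∀ x ∈ Ioo 0 a, gMu φ α x ≤ 2 := fun x hx =>
    (gMu_mono C.cφ C.φ0 (by linarith) (show x ∈ Ici 0 from hx.1.le) (show a ∈ Ici 0 from ha0.le)
      hx.2.le).trans hmua
  -- flux bounds
  have hV1 : ∀ x ∈ Ioo 0 a, - V x ≤ 1 / x := by
    intro x hx
    have hx0 := hx.1
    have m := mono_cmp (a := x) (b := a) (f := fun _ => (0:ℝ))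
      (g := fun t => ∫ s in (0:ℝ)..t, s * gMu φ α s * ψ s * Real.exp (U s))
      (f' := fun _ => 0) (g' := fun s => s * gMu φ α s * ψ s * Real.exp (U s))
      hx.2.le (by fun_prop) (prim_cont hfc).continuousOn (fun x _ => hasDerivAt_const _ _)
      (fun x _ => prim_deriv hfc x) (fun y hy => by
        have : 0 < y := by linarith [hy.1]
        have := C.ψ0 y
        have := gMu_pos φ α y
        positivity)
    have hE := S.eqn x ⟨hx.1.le, by linarith [hx.2]⟩
    have hm1 := hmu1 x hx0.le
    have hVn := S.V_nonpos C hl.le (r := x) ⟨hx.1, by linarith [hx.2]⟩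
    rw [le_div_iff₀ hx0]
    have h1 : x * gMu φ α x * (- V x) ≤ 1 := by
      have : lam * (∫ s in (0:ℝ)..x, s * gMu φ α s * ψ s * Real.exp (U s)) ≤
        lam * (∫ s in (0:ℝ)..a, s * gMu φ α s * ψ s * Real.exp (U s)) := by
        gcongr; linarith
      linarith
    have h2 : 0 ≤ x * (-V x) := mul_nonneg hx0.le (by linarith)
    nlinarith
  have hU1 : ∀ x ∈ Ioo 0 a, x * Real.exp (U x) ≤ a * Real.exp (U a) := by
    intro x hx
    have hx0 := hx.1
    have m := mono_cmp (a := x) (b := a) (f := fun x => - U x) (g := Real.log)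
      (f' := fun x => - V x) (g' := fun x => x⁻¹) hx.2.le S.cU.neg.continuousOn
      (Real.continuousOn_log.mono (fun y hy => by simp; linarith [hy.1]))
      (fun y hy => (S.dU y ⟨by linarith [hy.1], by linarith [hy.2]⟩).neg)
      (fun y hy => Real.hasDerivAt_log (by linarith [hy.1]))
      (fun y hy => by have := hV1 y ⟨by linarith [hy.1], hy.2⟩; rwa [one_div] at this)
    calc x * Real.exp (U x) = Real.exp (Real.log x + U x) := by
          rw [Real.exp_add, Real.exp_log hx0]
      _ ≤ Real.exp (Real.log a + U a) := by apply Real.exp_le_exp.2; linarith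
      _ = _ := by rw [Real.exp_add, Real.exp_log ha0]
  have hV2 : ∀ x ∈ Ioo 0 a, - V x ≤ 2 * lam * (a * Real.exp (U a)) := by
    intro x hx
    have hx0 := hx.1
    have m := mono_cmp (a := 0) (b := x)
      (f := fun t => ∫ s in (0:ℝ)..t, s * gMu φ α s * ψ s * Real.exp (U s))
      (g := fun t => 2 * (a * Real.exp (U a)) * t)
      (f' := fun s => s * gMu φ α s * ψ s * Real.exp (U s))
      (g' := fun t => 2 * (a * Real.exp (U a)))
      hx.1.le (prim_cont hfc).continuousOn (by fun_prop) 
      (fun x _ => prim_deriv hfc x) 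
      (fun x _ => ((hasDerivAt_id x).const_mul _).congr_deriv (by simp)) (fun y hy => by
        have hy0 := hy.1
        have hya : y ∈ Ioo 0 a := ⟨hy.1, by linarith [hy.2, hx.2]⟩
        have h1 := C.ψ0 y
        have h2 := C.ψ1 y
        have h3 := gMu_pos φ α y
        have h4 := hmu2 y hya
        have h5 := hU1 y hya
        calc _ = gMu φ α y * ψ y * (y * Real.exp (U y)) := by ring
          _ ≤ 2 * 1 * (a * Real.exp (U a)) := by gcongr
          _ = _ := by ring)
    have hE := S.eqn x ⟨hx.1.le, by linarith [hx.2]⟩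
    simp only [intervalIntegral.integral_same] at m
    have hm1 := hmu1 x hx0.le
    have hVn := S.V_nonpos C hl.le (r := x) ⟨hx.1, by linarith [hx.2]⟩
    have h1 : x * gMu φ α x * (- V x) ≤ lam * (2 * (a * Real.exp (U a)) * x) := by
      have : lam * (∫ s in (0:ℝ)..x, s * gMu φ α s * ψ s * Real.exp (U s)) ≤
        lam * (2 * (a * Real.exp (U a)) * x) := by
        gcongr; linarith
      linarith
    have h2 : 0 ≤ x * (-V x) := mul_nonneg hx0.le (by linarith)
    have h3 : x * (- V x) ≤ x * (2 * lam * (a * Real.exp (U a))) := by nlinarith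
    exact le_of_mul_le_mul_left h3 hx0
  have m1 := mono_cmp (a := 0) (b := a) (f := fun x => - U x)
      (g := fun x => 2 * lam * (a * Real.exp (U a)) * x)
      (f' := fun x => - V x) (g' := fun x => 2 * lam * (a * Real.exp (U a))) ha0.le
      S.cU.neg.continuousOn (by fun_prop)
      (fun y hy => (S.dU y ⟨by linarith [hy.1], by linarith [hy.2]⟩).neg)
      (fun x _ => ((hasDerivAt_id x).const_mul _).congr_deriv (by simp)) hV2
  have m2 := mono_cmp (a := 0) (b := a)
      (f := fun t => Real.exp (U a) / 4 * t ^ 2)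
      (g := fun t => ∫ s in (0:ℝ)..t, s * gMu φ α s * ψ s * Real.exp (U s))
      (f' := fun t => Real.exp (U a) / 2 * t)
      (g' := fun s => s * gMu φ α s * ψ s * Real.exp (U s))
      ha0.le (by fun_prop) (prim_cont hfc).continuousOn
      (fun x _ => ((hasDerivAt_pow 2 x).const_mul _).congr_deriv (by norm_num; ring))
      (fun x _ => prim_deriv hfc x) (fun y hy => by
        have hy0 := hy.1
        have h1 : 1 - L * y ≤ ψ y := C.ψL y ⟨hy0.le, by linarith [hy.2]⟩
        have h2 : L * y ≤ L * a := by have := hy.2.le; gcongr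
        have h3 := hmu1 y hy0.le
        have h4 : U a ≤ U y := S.anti C hl.le ⟨hy0.le, by linarith [hy.2]⟩ ⟨ha0.le, by linarith⟩ hy.2.le
        have h5 := Real.exp_le_exp.2 h4
        have h6 : (1/2:ℝ) ≤ ψ y := by linarith
        calc _ = y * 1 * (1/2) * Real.exp (U a) := by ring
          _ ≤ _ := by gcongr)
  simp only [intervalIntegral.integral_same] at m2
  have h1 : lam * (Real.exp (U a) / 4 * a ^ 2) ≤ 1 := by
    refine le_trans ?_ hΦ
    gcongr; linarith
  have h2 : U 0 ≤ U a + 8 := by nlinarith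
  have h3 : U a ≤ Real.log (512 * α / lam) := by
    rw [Real.le_log_iff_exp_le (by positivity), le_div_iff₀ hl]
    have : Real.exp (U a) * lam = (128 * α) * (lam * (Real.exp (U a) * a ^ 2)) := by
      linear_combination (-Real.exp (U a) * lam) * ha
    rw [this]
    nlinarith
  linarith

def hW (φ ψ : ℝ → ℝ) (α : ℝ) (w : ℝ → ℝ) (s : ℝ) : ℝ := s * gMu φ α s * ψ s * Real.exp (w s)
def FW (φ ψ : ℝ → ℝ) (α : ℝ) (w : ℝ → ℝ) (t : ℝ) : ℝ := ∫ s in (0:ℝ)..t, hW φ ψ α w s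
def kW (φ ψ : ℝ → ℝ) (α lam : ℝ) (w : ℝ → ℝ) (t : ℝ) : ℝ :=
  lam * FW φ ψ α w t / (t * gMu φ α t)

section gen
variable {φ ψ : ℝ → ℝ} {L α lam B : ℝ} {w : ℝ → ℝ}

theorem hW_nonneg (C : Cl φ ψ L) {s : ℝ} (hs : 0 ≤ s) : 0 ≤ hW φ ψ α w s := by
  have := C.ψ0 s
  have := gMu_pos φ α s
  unfold hW
  positivity

theorem hW_le (C : Cl φ ψ L) (hα : 0 ≤ α) (hB : ∀ r ∈ Icc (0:ℝ) 1, w r ≤ B) {s : ℝ}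
    (hs : s ∈ Icc (0:ℝ) 1) : hW φ ψ α w s ≤ gMu φ α 1 * Real.exp B := by
  have h1 := C.ψ0 s
  have h2 := C.ψ1 s
  have h3 := gMu_pos φ α s
  have h4 := gMu_mono C.cφ C.φ0 hα (show s ∈ Ici 0 from hs.1) (show (1:ℝ) ∈ Ici 0 by simp) hs.2
  have h5 := Real.exp_le_exp.2 (hB s hs)
  have h6 := hs.1
  have h7 := hs.2
  have h8 := gMu_pos φ α 1
  unfold hW
  calc _ ≤ 1 * gMu φ α 1 * 1 * Real.exp B := by gcongr
    _ = _ := by ring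

theorem hW_meas (C : Cl φ ψ L) (hw : Measurable w) : Measurable (hW φ ψ α w) := by
  have h1 := (gMu_cont C.cφ α).measurable
  have h2 := C.cψ.measurable
  unfold hW
  fun_prop

theorem hW_int (C : Cl φ ψ L) (hα : 0 ≤ α) (hw : Measurable w)
    (hB : ∀ r ∈ Icc (0:ℝ) 1, w r ≤ B) : IntegrableOn (hW φ ψ α w) (Icc 0 1) := by
  apply Measure.integrableOn_of_bounded (M := gMu φ α 1 * Real.exp B) (by simp)
    (hW_meas C hw).aestronglyMeasurable
  rw [ae_restrict_iff' measurableSet_Icc]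
  filter_upwards with s hs
  rw [Real.norm_eq_abs, abs_of_nonneg (hW_nonneg C hs.1)]
  exact hW_le C hα hB hs

theorem hW_ii (C : Cl φ ψ L) (hα : 0 ≤ α) (hw : Measurable w)
    (hB : ∀ r ∈ Icc (0:ℝ) 1, w r ≤ B) {a b : ℝ} (ha : a ∈ Icc (0:ℝ) 1) (hb : b ∈ Icc (0:ℝ) 1) :
    IntervalIntegrable (hW φ ψ α w) volume a b :=
  ((hW_int C hα hw hB).mono_set (uIcc_subset_Icc ha hb)).intervalIntegrable

theorem FW_nonneg (C : Cl φ ψ L) {t : ℝ} (ht : 0 ≤ t) : 0 ≤ FW φ ψ α w t :=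
  intervalIntegral.integral_nonneg ht fun _ hs => hW_nonneg C hs.1

theorem FW_le (C : Cl φ ψ L) (hα : 0 ≤ α) (hw : Measurable w)
    (hB : ∀ r ∈ Icc (0:ℝ) 1, w r ≤ B) {t : ℝ} (ht : t ∈ Icc (0:ℝ) 1) :
    FW φ ψ α w t ≤ gMu φ α 1 * Real.exp B * t := by
  have := intervalIntegral.integral_mono_on ht.1 (hW_ii C hα hw hB (by simp) ht)
    (intervalIntegrable_const (μ := volume) (c := gMu φ α 1 * Real.exp B))
    (fun s hs => hW_le C hα hB ⟨hs.1, hs.2.trans ht.2⟩)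
  simp only [intervalIntegral.integral_const, sub_zero, smul_eq_mul] at this
  unfold FW; linarith

theorem FW_cont (C : Cl φ ψ L) (hα : 0 ≤ α) (hw : Measurable w)
    (hB : ∀ r ∈ Icc (0:ℝ) 1, w r ≤ B) : ContinuousOn (FW φ ψ α w) (Icc 0 1) := by
  have := intervalIntegral.continuousOn_primitive_interval (μ := volume) (a := 0) (b := 1)
    (f := hW φ ψ α w) (by rw [uIcc_of_le zero_le_one]; exact hW_int C hα hw hB)
  rwa [uIcc_of_le zero_le_one] at this

theorem kW_nonneg (C : Cl φ ψ L) (hl : 0 ≤ lam) {t : ℝ} (ht : 0 ≤ t) :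
    0 ≤ kW φ ψ α lam w t := by
  have := FW_nonneg (α := α) (w := w) C ht
  have := gMu_pos φ α t
  unfold kW; positivity

theorem kW_le (C : Cl φ ψ L) (hα : 0 ≤ α) (hl : 0 ≤ lam) (hw : Measurable w)
    (hB : ∀ r ∈ Icc (0:ℝ) 1, w r ≤ B) {t : ℝ} (ht : t ∈ Icc (0:ℝ) 1) :
    kW φ ψ α lam w t ≤ lam * (gMu φ α 1 * Real.exp B) := by
  have hK : 0 ≤ lam * (gMu φ α 1 * Real.exp B) := by
    have := gMu_pos φ α 1
    positivity
  rcases eq_or_lt_of_le ht.1 with h | h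
  · rw [← h]; simpa [kW] using hK
  · have h1 := gMu_one_le C.cφ C.φ0 hα ht.1
    have h2 := FW_le C hα hw hB ht
    unfold kW
    rw [div_le_iff₀ (by positivity)]
    calc lam * FW φ ψ α w t ≤ lam * (gMu φ α 1 * Real.exp B * t) := by gcongr
      _ = lam * (gMu φ α 1 * Real.exp B) * (t * 1) := by ring
      _ ≤ _ := by gcongr

theorem kW_int (C : Cl φ ψ L) (hα : 0 ≤ α) (hl : 0 ≤ lam) (hw : Measurable w)
    (hB : ∀ r ∈ Icc (0:ℝ) 1, w r ≤ B) : IntegrableOn (kW φ ψ α lam w) (Icc 0 1) := by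
  have : IsFiniteMeasure (volume.restrict (Icc (0:ℝ) 1)) := ⟨by simp⟩
  refine Integrable.of_bound ?_ (lam * (gMu φ α 1 * Real.exp B)) ?_
  · have h1 : AEStronglyMeasurable (FW φ ψ α w) (volume.restrict (Icc 0 1)) :=
      (FW_cont C hα hw hB).aestronglyMeasurable measurableSet_Icc
    have h2 := (gMu_cont C.cφ α).measurable
    unfold kW
    have h3 : Measurable fun t => t * gMu φ α t := measurable_id.mul h2
    exact ((h1.aemeasurable.const_mul lam).div h3.aemeasurable).aestronglyMeasurable
  · rw [ae_restrict_iff' measurableSet_Icc]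
    filter_upwards with s hs
    rw [Real.norm_eq_abs, abs_of_nonneg (kW_nonneg C hl hs.1)]
    exact kW_le C hα hl hw hB hs

theorem kW_ii (C : Cl φ ψ L) (hα : 0 ≤ α) (hl : 0 ≤ lam) (hw : Measurable w)
    (hB : ∀ r ∈ Icc (0:ℝ) 1, w r ≤ B) {a b : ℝ} (ha : a ∈ Icc (0:ℝ) 1) (hb : b ∈ Icc (0:ℝ) 1) :
    IntervalIntegrable (kW φ ψ α lam w) volume a b :=
  ((kW_int C hα hl hw hB).mono_set (uIcc_subset_Icc ha hb)).intervalIntegrable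

theorem kW_mono (C : Cl φ ψ L) (hα : 0 ≤ α) (hl : 0 ≤ lam) {w' : ℝ → ℝ} (hw : Measurable w)
    (hw' : Measurable w') (hB : ∀ r ∈ Icc (0:ℝ) 1, w' r ≤ B)
    (h : ∀ r ∈ Icc (0:ℝ) 1, w r ≤ w' r) {t : ℝ} (ht : t ∈ Icc (0:ℝ) 1) :
    kW φ ψ α lam w t ≤ kW φ ψ α lam w' t := by
  have hB2 : ∀ r ∈ Icc (0:ℝ) 1, w r ≤ B := fun r hr => (h r hr).trans (hB r hr)
  have h1 : FW φ ψ α w t ≤ FW φ ψ α w' t := by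
    apply intervalIntegral.integral_mono_on ht.1 (hW_ii C hα hw hB2 (by simp) ht)
      (hW_ii C hα hw' hB (by simp) ht)
    intro s hs
    have h2 := h s ⟨hs.1, hs.2.trans ht.2⟩
    have h3 := C.ψ0 s
    have h4 := gMu_pos φ α s
    have h5 := hs.1
    unfold hW
    gcongr
  have h4 := gMu_pos φ α t
  have h5 := ht.1
  unfold kW
  gcongr

def clampR (r : ℝ) : ℝ := max 0 (min 1 r)
theorem clampR_mem (r : ℝ) : clampR r ∈ Icc (0:ℝ) 1 := by
  unfold clampR; constructor <;> simp
theorem clampR_eq {r : ℝ} (hr : r ∈ Icc (0:ℝ) 1) : clampR r = r := by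
  unfold clampR; rw [min_eq_right hr.2, max_eq_right hr.1]
theorem clampR_cont : Continuous clampR := by unfold clampR; fun_prop

def TW (φ ψ : ℝ → ℝ) (α lam : ℝ) (w : ℝ → ℝ) (r : ℝ) : ℝ :=
  ∫ t in (clampR r)..1, kW φ ψ α lam w t

theorem TW_cont (C : Cl φ ψ L) (hα : 0 ≤ α) (hl : 0 ≤ lam) (hw : Measurable w)
    (hB : ∀ r ∈ Icc (0:ℝ) 1, w r ≤ B) : Continuous (TW φ ψ α lam w) := by
  have h1 := intervalIntegral.continuousOn_primitive_interval (μ := volume) (a := 0) (b := 1)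
    (f := kW φ ψ α lam w) (by rw [uIcc_of_le zero_le_one]; exact kW_int C hα hl hw hB)
  rw [uIcc_of_le zero_le_one] at h1
  have h2 : TW φ ψ α lam w = fun r => (∫ t in (0:ℝ)..1, kW φ ψ α lam w t)
      - ∫ t in (0:ℝ)..(clampR r), kW φ ψ α lam w t := by
    funext r
    unfold TW
    rw [intervalIntegral.integral_interval_sub_left]
    · exact kW_ii C hα hl hw hB (by simp) (by simp)
    · exact kW_ii C hα hl hw hB (by simp) (clampR_mem r)
  rw [h2]
  exact continuous_const.sub (h1.comp_continuous clampR_cont clampR_mem)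

theorem TW_nonneg (C : Cl φ ψ L) (hl : 0 ≤ lam) (r : ℝ) : 0 ≤ TW φ ψ α lam w r :=
  intervalIntegral.integral_nonneg (clampR_mem r).2 fun _ ht =>
    kW_nonneg C hl ((clampR_mem r).1.trans ht.1)

theorem TW_mono (C : Cl φ ψ L) (hα : 0 ≤ α) (hl : 0 ≤ lam) {w' : ℝ → ℝ} (hw : Measurable w)
    (hw' : Measurable w') (hB : ∀ r ∈ Icc (0:ℝ) 1, w' r ≤ B)
    (h : ∀ r ∈ Icc (0:ℝ) 1, w r ≤ w' r) (r : ℝ) :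
    TW φ ψ α lam w r ≤ TW φ ψ α lam w' r := by
  have hB2 : ∀ r ∈ Icc (0:ℝ) 1, w r ≤ B := fun r hr => (h r hr).trans (hB r hr)
  apply intervalIntegral.integral_mono_on (clampR_mem r).2
    (kW_ii C hα hl hw hB2 (clampR_mem r) (by simp)) (kW_ii C hα hl hw' hB (clampR_mem r) (by simp))
  intro t ht
  exact kW_mono C hα hl hw hw' hB h ⟨(clampR_mem r).1.trans ht.1, ht.2⟩

/-- fixed point by monotone iteration -/
theorem exists_fixed (C : Cl φ ψ L) (hα : 0 ≤ α) (hl : 0 ≤ lam) {W : ℝ → ℝ} (hW0 : Measurable W)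
    (hWB : ∀ r ∈ Icc (0:ℝ) 1, W r ≤ B) (hWn : ∀ r ∈ Icc (0:ℝ) 1, 0 ≤ W r)
    (hT : ∀ r ∈ Icc (0:ℝ) 1, TW φ ψ α lam W r ≤ W r) :
    ∃ u : ℝ → ℝ, Continuous u ∧ ∀ r, u r = TW φ ψ α lam u r := by
  let U : ℕ → ℝ → ℝ := fun n => (TW φ ψ α lam)^[n] (fun _ => 0)
  have hU0 : U 0 = fun _ => 0 := rfl
  have hUs : ∀ n, U (n+1) = TW φ ψ α lam (U n) := fun n => Function.iterate_succ_apply' _ _ _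
  have hcl : ∀ n r, U n r = U n (clampR r) := by
    intro n r
    cases n with
    | zero => rfl
    | succ n => rw [hUs]; unfold TW; rw [clampR_eq (clampR_mem r)]
  have hP : ∀ n, Measurable (U n) ∧ (∀ r ∈ Icc (0:ℝ) 1, U n r ≤ W r) := by
    intro n
    induction n with
    | zero => exact ⟨measurable_const, hWn⟩
    | succ n ih =>
      rw [hUs]
      refine ⟨(TW_cont C hα hl ih.1 fun r hr => (ih.2 r hr).trans (hWB r hr)).measurable, ?_⟩
      intro r hr
      exact (TW_mono C hα hl ih.1 hW0 hWB ih.2 r).trans (hT r hr)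
  have hUB : ∀ n, ∀ r ∈ Icc (0:ℝ) 1, U n r ≤ B := fun n r hr => ((hP n).2 r hr).trans (hWB r hr)
  have hmono : ∀ n r, U n r ≤ U (n+1) r := by
    intro n
    induction n with
    | zero => intro r; rw [hUs]; exact TW_nonneg C hl r
    | succ n ih =>
      intro r
      rw [hUs (n+1)]
      conv_lhs => rw [hUs n]
      exact TW_mono C hα hl (hP n).1 (hP (n+1)).1 (hUB (n+1)) (fun r _ => ih r) r
  have hlim : ∀ r, ∃ l, Tendsto (fun n => U n r) atTop (nhds l) := by
    intro r
    refine ⟨_, tendsto_atTop_ciSup (monotone_nat_of_le_succ fun n => hmono n r) ⟨B, ?_⟩⟩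
    rintro _ ⟨n, rfl⟩
    change U n r ≤ B
    rw [hcl]
    exact hUB n _ (clampR_mem r)
  choose u hu using hlim
  have hum : Measurable u :=
    measurable_of_tendsto_metrizable (fun n => (hP n).1) (tendsto_pi_nhds.2 hu)
  have huB : ∀ r ∈ Icc (0:ℝ) 1, u r ≤ B := fun r hr =>
    le_of_tendsto (hu r) (Eventually.of_forall fun n => hUB n r hr)
  have hF : ∀ t ∈ Icc (0:ℝ) 1, Tendsto (fun n => FW φ ψ α (U n) t) atTop (nhds (FW φ ψ α u t)) := by
    intro t ht
    apply intervalIntegral.tendsto_integral_filter_of_dominated_convergence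
      (fun _ => gMu φ α 1 * Real.exp B)
    · exact Eventually.of_forall fun n => (hW_meas C (hP n).1).aestronglyMeasurable
    · refine Eventually.of_forall fun n => Eventually.of_forall fun s hs => ?_
      rw [uIoc_of_le ht.1] at hs
      rw [Real.norm_eq_abs, abs_of_nonneg (hW_nonneg C hs.1.le)]
      exact hW_le C hα (hUB n) ⟨hs.1.le, hs.2.trans ht.2⟩
    · exact intervalIntegrable_const
    · refine Eventually.of_forall fun s hs => ?_
      unfold hW
      exact ((Real.continuous_exp.tendsto _).comp (hu s)).const_mul _
  have hk : ∀ t ∈ Icc (0:ℝ) 1,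
      Tendsto (fun n => kW φ ψ α lam (U n) t) atTop (nhds (kW φ ψ α lam u t)) := by
    intro t ht
    exact ((hF t ht).const_mul lam).div_const _
  have hTT : ∀ r, Tendsto (fun n => TW φ ψ α lam (U n) r) atTop (nhds (TW φ ψ α lam u r)) := by
    intro r
    have hc := clampR_mem r
    apply intervalIntegral.tendsto_integral_filter_of_dominated_convergence
      (fun _ => lam * (gMu φ α 1 * Real.exp B))
    · refine Eventually.of_forall fun n => ?_
      have := (kW_ii (lam := lam) C hα hl (hP n).1 (hUB n) hc (show (1:ℝ) ∈ Icc (0:ℝ) 1 by simp))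
      rw [uIoc_of_le hc.2]
      exact this.1.aestronglyMeasurable
    · refine Eventually.of_forall fun n => Eventually.of_forall fun s hs => ?_
      rw [uIoc_of_le hc.2] at hs
      have hs' : s ∈ Icc (0:ℝ) 1 := ⟨hc.1.trans hs.1.le, hs.2⟩
      rw [Real.norm_eq_abs, abs_of_nonneg (kW_nonneg C hl hs'.1)]
      exact kW_le C hα hl (hP n).1 (hUB n) hs'
    · exact intervalIntegrable_const
    · refine Eventually.of_forall fun s hs => ?_
      rw [uIoc_of_le hc.2] at hs
      exact hk s ⟨hc.1.trans hs.1.le, hs.2⟩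
  have hfix : ∀ r, u r = TW φ ψ α lam u r := by
    intro r
    refine tendsto_nhds_unique ((tendsto_add_atTop_iff_nat 1).2 (hu r)) ?_
    simp only [hUs]
    exact hTT r
  refine ⟨u, ?_, hfix⟩
  have : u = TW φ ψ α lam u := funext hfix
  rw [this]
  exact TW_cont C hα hl hum huB

end gen

def gZ (L α r : ℝ) : ℝ :=
  1 / 2 * Real.log (1 + α * r ^ 2) + α * r ^ 2 / (1 + α * r ^ 2) + 2 * L * |r|

def zZ (L α ε κ r : ℝ) : ℝ := ε + κ / α * gZ L α r

def pP (L α r : ℝ) : ℝ :=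
  α * r ^ 2 * (α * r ^ 2 + 3) / (1 + α * r ^ 2) ^ 2 + 2 * L * r

theorem gZ_cont {L α : ℝ} (hα : 0 ≤ α) : Continuous (gZ L α) := by
  unfold gZ
  have : ∀ x : ℝ, 1 + α * x ^ 2 ≠ 0 := fun x => by positivity
  apply Continuous.add (Continuous.add _ _) (by fun_prop)
  · exact continuous_const.mul (Continuous.log (by fun_prop) this)
  · exact Continuous.div (by fun_prop) (by fun_prop) this

theorem gZ_nonneg {L α : ℝ} (hα : 0 ≤ α) (hL : 0 ≤ L) (r : ℝ) : 0 ≤ gZ L α r := by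
  unfold gZ
  have : 0 ≤ Real.log (1 + α * r ^ 2) := Real.log_nonneg (by nlinarith [sq_nonneg r, mul_nonneg hα (sq_nonneg r)])
  positivity

theorem sqD (α r : ℝ) : HasDerivAt (fun r : ℝ => α * r ^ 2) (2 * α * r) r :=
  ((hasDerivAt_pow 2 r).const_mul α).congr_deriv (by norm_num; ring)

theorem gZ_deriv {L α r : ℝ} (hα : 0 ≤ α) (hr : 0 < r) :
    HasDerivAt (gZ L α) (pP L α r / r) r := by
  have h0 : 1 + α * r ^ 2 ≠ 0 := by positivity
  have h1 := (sqD α r).const_add 1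
  have h2 := ((h1.log h0).const_mul (1/2)).add ((sqD α r).div h1 h0)
  have h3 := h2.add ((hasDerivAt_abs_pos hr).const_mul (2 * L))
  refine HasDerivAt.congr_deriv (f := gZ L α) h3 ?_
  unfold pP
  field_simp
  ring

theorem pP_deriv {L α r : ℝ} (hα : 0 ≤ α) :
    HasDerivAt (pP L α) (2 * α * r * (3 - α * r ^ 2) / (1 + α * r ^ 2) ^ 3 + 2 * L) r := by
  have h0 : 1 + α * r ^ 2 ≠ 0 := by positivity
  have h1 := (sqD α r).const_add 1
  have h2 := (((sqD α r).mul ((sqD α r).add_const 3)).div (h1.pow 2) (pow_ne_zero 2 h0)).add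
    ((hasDerivAt_id r).const_mul (2 * L))
  refine HasDerivAt.congr_deriv (f := pP L α) h2 ?_
  simp
  field_simp
  ring

theorem pP_nonneg {L α r : ℝ} (hα : 0 ≤ α) (hL : 0 ≤ L) (hr : 0 ≤ r) : 0 ≤ pP L α r := by
  unfold pP; positivity

theorem pP_alg {L α r f : ℝ} (hα : 0 < α) (hr : 0 < r) (hL : 0 ≤ L)
    (hf : 1 / 2 ≤ f) (hf1 : f ≤ 1) (hfL : 1 - L * r ≤ f) :
    α * r ≤ α * (r * f) * pP L α r + (2 * α * r * (3 - α * r ^ 2) / (1 + α * r ^ 2) ^ 3 + 2 * L) := by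
  unfold pP
  have hx : 0 ≤ α * r ^ 2 := by positivity
  set x := α * r ^ 2 with hxd
  have key : f ≤ f * (x * (x + 3) / (1 + x) ^ 2) + 2 * (3 - x) / (1 + x) ^ 3 := by
    have e : f * (x * (x + 3) / (1 + x) ^ 2) + 2 * (3 - x) / (1 + x) ^ 3 - f
      = (f * (x ^ 2 - 1) + 6 - 2 * x) / (1 + x) ^ 3 := by
      field_simp; ring
    have : 0 ≤ (f * (x ^ 2 - 1) + 6 - 2 * x) / (1 + x) ^ 3 := by
      apply div_nonneg _ (by positivity)
      nlinarith [sq_nonneg (x - 2), mul_nonneg (sub_nonneg.2 hf) (sq_nonneg x)]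
    linarith
  have h2 : α * r * f ≤ α * r * (f * (x * (x + 3) / (1 + x) ^ 2) + 2 * (3 - x) / (1 + x) ^ 3) := by
    gcongr
  have h3 : 0 ≤ α * r := by positivity
  have h4 : α * r * (L * r) ≤ α * (r * f) * (2 * L * r) := by
    have : 0 ≤ α * r * (L * r) := by positivity
    nlinarith
  have h5 : α * r * (1 - L * r) ≤ α * r * f := by gcongr
  have h6 : 2 * α * r * (3 - x) / (1 + x) ^ 3 = α * r * (2 * (3 - x) / (1 + x) ^ 3) := by ring
  rw [h6]
  nlinarith

theorem pP_bd {L α r : ℝ} (hα : 1 ≤ α) (hr : 0 < r) (hL : 0 ≤ L) :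
    (pP L α r / r) ^ 2 ≤ α * (2 * L + 2) ^ 2 := by
  have hs : Real.sqrt α ^ 2 = α := Real.sq_sqrt (by linarith)
  have hs1 : 1 ≤ Real.sqrt α := Real.one_le_sqrt.2 hα
  set q := Real.sqrt α
  have h1 : pP L α r / r = α * r * (α * r ^ 2 + 3) / (1 + α * r ^ 2) ^ 2 + 2 * L := by
    unfold pP; field_simp
  have h2 : α * r * (α * r ^ 2 + 3) / (1 + α * r ^ 2) ^ 2 ≤ 2 * q := by
    rw [← hs]
    rw [div_le_iff₀ (by positivity)]
    have : q ^ 2 * r ^ 2 = (q * r) ^ 2 := by ring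
    rw [this]
    have hy : 0 ≤ q * r := by positivity
    have : q ^ 2 * r = q * (q * r) := by ring
    rw [this]
    set y := q * r
    have : y * (y ^ 2 + 3) ≤ 2 * (1 + y ^ 2) ^ 2 := by nlinarith [sq_nonneg (y - 1), sq_nonneg (y^2 - y), sq_nonneg (y^2-1)]
    nlinarith
  have h3 : 0 ≤ pP L α r / r := div_nonneg (pP_nonneg (by linarith) hL hr.le) hr.le
  have h4 : pP L α r / r ≤ q * (2 * L + 2) := by rw [h1]; nlinarith
  calc (pP L α r / r) ^ 2 ≤ (q * (2 * L + 2)) ^ 2 := by gcongr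
    _ = _ := by rw [mul_pow, hs]

theorem superW_core {φ ψ M : ℝ → ℝ} {L α lam ε κ w1 : ℝ} (C : Cl φ ψ L)
    (hM1 : ∀ t ∈ Ico (0:ℝ) 1, 1 ≤ M t) (hMint : IntegrableOn M (Ioo 0 1))
    (hMψ : ∀ s t, 0 ≤ s → s ≤ t → t < 1 → ψ s ≤ M t * φ s)
    (hα : 1 ≤ α) (hε : 0 < ε) (hκ : 0 < κ) (hl : 0 < lam) (hlκ : lam ≤ κ)
    (hw0 : 0 ≤ w1) (hw2 : w1 ≤ 1 / 2)
    (hZδ : ε + κ / α * gZ L α (1 / (2 * L)) = 1 - w1)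
    (hlam : lam ≤ κ - κ ^ 2 * (2 * L + 2) ^ 2 / (α * ε))
    (hw1 : 16 * L * κ / α * ∫ t in (0:ℝ)..1, M t ≤ w1) :
    ∃ W : ℝ → ℝ, ∃ B, Measurable W ∧ (∀ r ∈ Icc (0:ℝ) 1, W r ≤ B) ∧
      (∀ r ∈ Icc (0:ℝ) 1, 0 ≤ W r) ∧ ∀ r ∈ Icc (0:ℝ) 1, TW φ ψ α lam W r ≤ W r := by
  have hL := C.hL
  have hα0 : 0 < α := by linarith
  set δ := 1 / (2 * L) with hδ
  have hδ0 : 0 < δ := by positivity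
  have hδ2 : δ ≤ 1 / 2 := half_bd hL
  have hLδ : L * δ = 1 / 2 := by rw [hδ]; field_simp
  set Z := zZ L α ε κ with hZ
  have hZc : Continuous Z := by
    have := gZ_cont (L := L) hα0.le
    rw [hZ]; unfold zZ; fun_prop
  have hZε : ∀ r, ε ≤ Z r := fun r => by
    have := gZ_nonneg (L := L) hα0.le (by linarith) r
    rw [hZ]; unfold zZ
    have : 0 ≤ κ / α * gZ L α r := by positivity
    linarith
  have hZ0 : ∀ r, 0 < Z r := fun r => hε.trans_le (hZε r)
  have hZδ' : Z δ = 1 - w1 := hZδ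
  have hZd : ∀ r, 0 < r → HasDerivAt Z (κ / α * (pP L α r / r)) r := fun r hr =>
    ((gZ_deriv hα0.le hr).const_mul (κ / α)).const_add ε
  have hZmono : ∀ r ∈ Icc 0 δ, Z r ≤ Z δ := by
    intro r hr
    have := mono_cmp (a := r) (b := δ) (f := fun _ => (0:ℝ)) (g := Z) (f' := fun _ => 0)
      (g' := fun r => κ / α * (pP L α r / r)) hr.2 (by fun_prop) hZc.continuousOn
      (fun x _ => hasDerivAt_const _ _) (fun x hx => hZd x (by linarith [hx.1, hr.1]))
      (fun x hx => by
        have hx0 : 0 < x := by linarith [hx.1, hr.1]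
        have := pP_nonneg (r := x) hα0.le (show 0 ≤ L by linarith) hx0.le
        positivity)
    linarith
  let W : ℝ → ℝ := fun r => if r ≤ δ then - Real.log (Z r) else w1
  have hWin : ∀ r, r ≤ δ → W r = - Real.log (Z r) := fun r hr => if_pos hr
  have hWout : ∀ r, δ < r → W r = w1 := fun r hr => if_neg (not_le.2 hr)
  have hWm : Measurable W :=
    Measurable.ite measurableSet_Iic (Real.measurable_log.comp hZc.measurable).neg measurable_const
  have hε1 : ε ≤ 1 := by have := hZε δ; linarith
  have hlogδ : w1 ≤ - Real.log (Z δ) := by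
    have := Real.log_le_sub_one_of_pos (hZ0 δ); linarith
  have hWB : ∀ r ∈ Icc (0:ℝ) 1, W r ≤ - Real.log ε := by
    intro r _
    have h1 : ∀ r, - Real.log (Z r) ≤ - Real.log ε := fun r =>
      neg_le_neg (Real.log_le_log hε (hZε r))
    by_cases h : r ≤ δ
    · rw [hWin r h]; exact h1 r
    · rw [hWout r (not_le.1 h)]; exact hlogδ.trans (h1 δ)
  have hWn : ∀ r ∈ Icc (0:ℝ) 1, 0 ≤ W r := by
    intro r hr
    by_cases h : r ≤ δ
    · rw [hWin r h]
      have := Real.log_nonpos (hZ0 r).le (by have := hZmono r ⟨hr.1, h⟩; linarith)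
      linarith
    · rw [hWout r (not_le.1 h)]; exact hw0
  have hWexp : ∀ r, δ ≤ r → Real.exp (W r) ≤ 2 := by
    intro r hr
    rcases eq_or_lt_of_le hr with h | h
    · rw [← h, hWin δ le_rfl, Real.exp_neg, Real.exp_log (hZ0 δ), hZδ',
        inv_le_comm₀ (by linarith) (by norm_num)]
      linarith
    · rw [hWout r h]
      have h1 : Real.exp w1 ≤ Real.exp (1/2) := Real.exp_le_exp.2 hw2
      have h2 := Real.one_sub_le_exp_neg (1/2)
      rw [Real.exp_neg] at h2
      have h4 : Real.exp (1/2) ≤ 2 := by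
        rw [← inv_inv (Real.exp (1/2)), inv_le_comm₀ (by positivity) (by norm_num)]
        linarith
      linarith
  have hmu := gMu_cont C.cφ α
  have hψc := C.cψ
  -- inner flux
  have hin : ∀ t ∈ Icc 0 δ, lam * FW φ ψ α W t ≤ κ / α * (gMu φ α t * pP L α t / Z t) := by
    intro t ht
    have hcH : Continuous fun s => s * gMu φ α s * ψ s * (Z s)⁻¹ :=
      ((continuous_id.mul hmu).mul hψc).mul (hZc.inv₀ fun s => (hZ0 s).ne')
    have e : FW φ ψ α W t = ∫ s in (0:ℝ)..t, s * gMu φ α s * ψ s * (Z s)⁻¹ := by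
      unfold FW
      apply intervalIntegral.integral_congr
      intro s hs
      rw [uIcc_of_le ht.1] at hs
      simp only [hW]
      rw [hWin s (hs.2.trans ht.2), Real.exp_neg, Real.exp_log (hZ0 s)]
    have hPc : Continuous (pP L α) := continuous_iff_continuousAt.2 fun r =>
      (pP_deriv hα0.le).continuousAt
    have m := mono_cmp (a := 0) (b := t)
      (f := fun t => lam * ∫ s in (0:ℝ)..t, s * gMu φ α s * ψ s * (Z s)⁻¹)
      (g := fun t => κ / α * (gMu φ α t * pP L α t / Z t))
      (f' := fun s => lam * (s * gMu φ α s * ψ s * (Z s)⁻¹))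
      (g' := fun r => κ / α * (((gMu φ α r * (α * (r * φ r)) * pP L α r
        + gMu φ α r * (2 * α * r * (3 - α * r ^ 2) / (1 + α * r ^ 2) ^ 3 + 2 * L)) * Z r
        - gMu φ α r * pP L α r * (κ / α * (pP L α r / r))) / Z r ^ 2))
      ht.1 ((prim_cont hcH).const_mul _).continuousOn
      (((hmu.mul hPc).div hZc fun s => (hZ0 s).ne').const_mul _).continuousOn
      (fun x _ => (prim_deriv hcH x).const_mul _)
      (fun x hx => ((((gMu_deriv C.cφ α x).mul (pP_deriv hα0.le)).div (hZd x hx.1)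
        (hZ0 x).ne').const_mul _))
      (fun x hx => by
        have hx0 := hx.1
        have hxδ : x ≤ δ := hx.2.le.trans ht.2
        have hx1 : x ≤ 1 := by linarith
        have hm := gMu_pos φ α x
        have hz := hZ0 x
        have hfL := C.φL x ⟨hx0.le, hx1⟩
        have hLx := Lx_half hL hxδ
        have ha := pP_alg hα0 hx0 (by linarith : 0 ≤ L) (by linarith) (C.φ1 x) hfL
        have hb := pP_bd hα hx0 (by linarith : 0 ≤ L)
        set P := pP L α x with hP
        set P' := 2 * α * x * (3 - α * x ^ 2) / (1 + α * x ^ 2) ^ 3 + 2 * L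
        -- target: lam x m ψ / Z ≤ κ/α * m/Z * (αxφP + P' - P Z'/Z)
        have hq : κ / α * (κ / α * (P * (P / x))) / Z x ≤ x * (κ ^ 2 * (2 * L + 2) ^ 2 / (α * ε)) := by
          calc κ / α * (κ / α * (P * (P / x))) / Z x = x * (κ ^ 2 / α ^ 2 * (P / x) ^ 2 / Z x) := by
                field_simp
            _ ≤ x * (κ ^ 2 / α ^ 2 * (α * (2 * L + 2) ^ 2) / ε) := by
                have := hZε x
                gcongr
            _ = _ := by field_simp
        have hmain : lam * x ≤ κ / α * (α * (x * φ x) * P + P') - κ / α * (κ / α * (P * (P / x))) / Z x := by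
          have h1 : κ / α * (α * x) ≤ κ / α * (α * (x * φ x) * P + P') := by gcongr
          have h2 : κ / α * (α * x) = κ * x := by field_simp
          have h3 : lam * x ≤ (κ - κ ^ 2 * (2 * L + 2) ^ 2 / (α * ε)) * x := by gcongr
          linarith
        have hψ := C.ψ1 x
        calc lam * (x * gMu φ α x * ψ x * (Z x)⁻¹)
            ≤ lam * (x * gMu φ α x * 1 * (Z x)⁻¹) := by gcongr
          _ = (lam * x) * (gMu φ α x / Z x) := by field_simp
          _ ≤ (κ / α * (α * (x * φ x) * P + P') - κ / α * (κ / α * (P * (P / x))) / Z x)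
              * (gMu φ α x / Z x) := by gcongr
          _ = _ := by field_simp)
    have hz0 : pP L α 0 = 0 := by simp [pP]
    simp only [intervalIntegral.integral_same, hz0] at m
    rw [e]
    simpa using m
  have hkin : ∀ t ∈ Ioc 0 δ, kW φ ψ α lam W t ≤ κ / α * (pP L α t / t) / Z t := by
    intro t ht
    have h := hin t ⟨ht.1.le, ht.2⟩
    have hm := gMu_pos φ α t
    have hz := hZ0 t
    have ht0 := ht.1
    unfold kW
    rw [div_le_iff₀ (by positivity)]
    calc _ ≤ _ := h
      _ = _ := by field_simp
  -- outer flux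
  have hδm : δ ∈ Icc (0:ℝ) 1 := ⟨hδ0.le, by linarith⟩
  have hkout : ∀ t ∈ Ioo δ 1, kW φ ψ α lam W t ≤ 16 * L * κ / α * M t := by
    intro t ht
    have ht0 : 0 < t := by linarith [ht.1]
    have htm : t ∈ Icc (0:ℝ) 1 := ⟨ht0.le, ht.2.le⟩
    have hMt := hM1 t ⟨ht0.le, ht.2⟩
    have hm := gMu_pos φ α t
    have hmδ := gMu_pos φ α δ
    have hmm := gMu_mono C.cφ C.φ0 hα0.le (show δ ∈ Ici 0 from hδ0.le) (show t ∈ Ici 0 from ht0.le)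
      ht.1.le
    have hsplit : FW φ ψ α W t = FW φ ψ α W δ + ∫ s in δ..t, hW φ ψ α W s := by
      unfold FW
      rw [intervalIntegral.integral_add_adjacent_intervals
        (hW_ii C hα0.le hWm hWB (by simp) hδm) (hW_ii C hα0.le hWm hWB hδm htm)]
    have h2 : (∫ s in δ..t, hW φ ψ α W s) ≤ 2 * M t / α * gMu φ α t - 2 * M t / α * gMu φ α δ := by
      apply intervalIntegral.integral_le_sub_of_hasDeriv_right_of_le
        (g := fun s => 2 * M t / α * gMu φ α s)
        (g' := fun s => 2 * M t / α * (gMu φ α s * (α * (s * φ s)))) ht.1.le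
        (hmu.const_mul _).continuousOn
        (fun x _ => ((gMu_deriv C.cφ α x).const_mul _).hasDerivWithinAt)
        ((hW_int C hα0.le hWm hWB).mono_set (Icc_subset_Icc hδ0.le ht.2.le))
      intro x hx
      have hx0 : 0 < x := by linarith [hx.1]
      have h1 := hWexp x hx.1.le
      have h3 := hMψ x t hx0.le hx.2.le ht.2
      have h4 := gMu_pos φ α x
      have h5 := C.ψ0 x
      have h6 : 0 ≤ M t * φ x := h5.trans h3
      unfold hW
      calc _ ≤ x * gMu φ α x * (M t * φ x) * 2 := by gcongr
        _ = _ := by field_simp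
    have h3 := hin δ ⟨hδ0.le, le_rfl⟩
    have hPδ : pP L α δ ≤ 3 := by
      unfold pP
      have : α * δ ^ 2 * (α * δ ^ 2 + 3) / (1 + α * δ ^ 2) ^ 2 ≤ 2 := by
        have : 0 ≤ α * δ ^ 2 := by positivity
        rw [div_le_iff₀ (by positivity)]
        nlinarith
      nlinarith
    have h4 : lam * FW φ ψ α W δ ≤ κ / α * (gMu φ α t * 3 / (1/2)) := by
      refine h3.trans ?_
      have : (1/2:ℝ) ≤ Z δ := by rw [hZδ']; linarith
      have := pP_nonneg (r := δ) hα0.le (show 0 ≤ L by linarith) hδ0.le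
      gcongr
    have h5 : lam * (∫ s in δ..t, hW φ ψ α W s) ≤ κ / α * (2 * M t * gMu φ α t) := by
      have hq : (∫ s in δ..t, hW φ ψ α W s) ≤ 2 * M t / α * gMu φ α t := by
        have : 0 ≤ 2 * M t / α * gMu φ α δ := by positivity
        linarith
      calc _ ≤ κ * (2 * M t / α * gMu φ α t) := by
            have : 0 ≤ 2 * M t / α * gMu φ α t := by positivity
            exact (mul_le_mul_of_nonneg_left hq hl.le).trans (mul_le_mul_of_nonneg_right hlκ this)
        _ = _ := by field_simp
    unfold kW
    rw [div_le_iff₀ (by positivity), hsplit, mul_add]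
    have hLt : 1 / 2 ≤ L * t := by rw [← hLδ]; have := ht.1.le; gcongr
    calc _ ≤ κ / α * (gMu φ α t * 3 / (1/2)) + κ / α * (2 * M t * gMu φ α t) := by linarith
      _ = κ / α * gMu φ α t * (6 * 1 + 2 * M t) := by ring
      _ ≤ κ / α * gMu φ α t * (6 * M t + 2 * M t) := by gcongr
      _ = 16 * (1 / 2) * κ / α * M t * gMu φ α t := by ring
      _ ≤ 16 * (L * t) * κ / α * M t * gMu φ α t := by gcongr
      _ = _ := by ring
  have hMii : ∀ a ∈ Icc (0:ℝ) 1, ∀ b ∈ Icc (0:ℝ) 1, IntervalIntegrable M volume a b := by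
    intro a ha b hb
    have : IntegrableOn M (Icc 0 1) := by rwa [integrableOn_Icc_iff_integrableOn_Ioo]
    exact (this.mono_set (uIcc_subset_Icc ha hb)).intervalIntegrable
  have hO : ∀ r ∈ Icc δ 1, (∫ t in r..1, kW φ ψ α lam W t) ≤ w1 := by
    intro r hr
    have hrm : r ∈ Icc (0:ℝ) 1 := ⟨by linarith [hr.1], hr.2⟩
    have h1 : (∫ t in r..1, kW φ ψ α lam W t) ≤ ∫ t in r..1, 16 * L * κ / α * M t := by
      apply intervalIntegral.integral_mono_on_of_le_Ioo hr.2
        (kW_ii C hα0.le hl.le hWm hWB hrm (by simp)) ((hMii r hrm 1 (by simp)).const_mul _)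
      intro t ht
      exact hkout t ⟨by linarith [ht.1, hr.1], ht.2⟩
    rw [intervalIntegral.integral_const_mul] at h1
    have h2 : (∫ t in r..1, M t) ≤ ∫ t in (0:ℝ)..1, M t := by
      rw [← intervalIntegral.integral_add_adjacent_intervals (hMii 0 (by simp) r hrm)
        (hMii r hrm 1 (by simp))]
      have : 0 ≤ ∫ t in (0:ℝ)..r, M t := by
        have := intervalIntegral.integral_mono_on_of_le_Ioo hrm.1
          (intervalIntegrable_const (c := (0:ℝ)) (μ := volume)) (hMii 0 (by simp) r hrm)
          (fun x hx => (by linarith [hM1 x ⟨hx.1.le, by linarith [hx.2, hr.2]⟩] : (0:ℝ) ≤ M x))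
        simpa using this
      linarith
    have h3 : 16 * L * κ / α * ∫ t in r..1, M t ≤ 16 * L * κ / α * ∫ t in (0:ℝ)..1, M t := by
      gcongr
    linarith
  refine ⟨W, - Real.log ε, hWm, hWB, hWn, ?_⟩
  intro r hr
  unfold TW
  rw [clampR_eq hr]
  by_cases h : r ≤ δ
  · rw [hWin r h]
    have e : (∫ t in r..1, kW φ ψ α lam W t) = (∫ t in r..δ, kW φ ψ α lam W t)
        + ∫ t in δ..1, kW φ ψ α lam W t := by
      rw [intervalIntegral.integral_add_adjacent_intervals
        (kW_ii C hα0.le hl.le hWm hWB hr hδm) (kW_ii C hα0.le hl.le hWm hWB hδm (by simp))]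
    have h1 := hO δ ⟨le_rfl, hδm.2⟩
    have h2 : (∫ t in r..δ, kW φ ψ α lam W t) ≤ Real.log (Z δ) - Real.log (Z r) := by
      apply intervalIntegral.integral_le_sub_of_hasDeriv_right_of_le
        (g := fun s => Real.log (Z s))
        (g' := fun t => κ / α * (pP L α t / t) / Z t) h
        (hZc.log fun s => (hZ0 s).ne').continuousOn
        (fun x hx => ((hZd x (by linarith [hx.1, hr.1])).log (hZ0 x).ne').hasDerivWithinAt)
        ((kW_int C hα0.le hl.le hWm hWB).mono_set (Icc_subset_Icc hr.1 hδm.2))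
      intro x hx
      exact hkin x ⟨by linarith [hx.1, hr.1], hx.2.le⟩
    rw [e]; linarith
  · rw [hWout r (not_le.1 h)]
    exact hO r ⟨(not_le.1 h).le, hr.2⟩

def phiB (D : GelfandData) (r : ℝ) : ℝ := D.phi (clampR r)
def psiB (D : GelfandData) (r : ℝ) : ℝ := D.psi (clampR r)

theorem phiB_eq (D : GelfandData) {r : ℝ} (hr : r ∈ Icc (0:ℝ) 1) : phiB D r = D.phi r := by
  unfold phiB; rw [clampR_eq hr]
theorem psiB_eq (D : GelfandData) {r : ℝ} (hr : r ∈ Icc (0:ℝ) 1) : psiB D r = D.psi r := by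
  unfold psiB; rw [clampR_eq hr]

theorem lip_low {h : ℝ → ℝ} {K : NNReal} (hh : LipschitzOnWith K h (Icc 0 1)) (h0 : h 0 = 1)
    {r : ℝ} (hr : r ∈ Icc (0:ℝ) 1) : 1 - K * r ≤ h r := by
  have := hh.dist_le_mul r hr 0 (by simp)
  rw [Real.dist_eq, Real.dist_eq, h0, sub_zero, abs_of_nonneg hr.1] at this
  have := (abs_le.1 this).1
  linarith

theorem exists_Cl (D : GelfandData) : ∃ L, Cl (phiB D) (psiB D) L := by
  obtain ⟨K1, h1⟩ := D.phi_lip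
  obtain ⟨K2, h2⟩ := D.psi_lip
  have z0 : (0:ℝ) ∈ Icc (0:ℝ) 1 := by simp
  refine ⟨1 + K1 + K2, ?_, ?_, ?_, ?_, ?_, ?_, ?_, ?_, ?_⟩
  · exact h1.continuousOn.comp_continuous clampR_cont clampR_mem
  · exact h2.continuousOn.comp_continuous clampR_cont clampR_mem
  · exact fun r => D.phi_nonneg _ (clampR_mem r)
  · intro r
    have := D.phi_anti z0 (clampR_mem r) (clampR_mem r).1
    rwa [D.phi_zero] at this
  · exact fun r => D.psi_nonneg _ (clampR_mem r)
  · intro r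
    have := D.psi_anti z0 (clampR_mem r) (clampR_mem r).1
    rwa [D.psi_zero] at this
  · have := K1.2
    have := K2.2
    simp only [NNReal.val_eq_coe] at *
    linarith
  · intro r hr
    rw [phiB_eq D hr]
    have h3 := lip_low h1 D.phi_zero hr
    have h4 : 0 ≤ (K2:ℝ) * r := mul_nonneg K2.2 hr.1
    have := hr.1
    nlinarith
  · intro r hr
    rw [psiB_eq D hr]
    have h3 := lip_low h2 D.psi_zero hr
    have h4 : 0 ≤ (K1:ℝ) * r := mul_nonneg K1.2 hr.1
    have := hr.1
    nlinarith

theorem M_one (D : GelfandData) : ∀ t ∈ Ico (0:ℝ) 1, 1 ≤ D.M t := by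
  intro t ht
  have := (D.M_def t ht).2 (mem_image_of_mem _ (left_mem_Icc.2 ht.1))
  simpa [D.phi_zero, D.psi_zero] using this

theorem M_psi (D : GelfandData) : ∀ s t, 0 ≤ s → s ≤ t → t < 1 →
    psiB D s ≤ D.M t * phiB D s := by
  intro s t h0 hst ht
  have hs : s ∈ Icc (0:ℝ) 1 := ⟨h0, by linarith⟩
  rw [phiB_eq D hs, psiB_eq D hs]
  have := (D.M_def t ⟨by linarith, ht⟩).2 (mem_image_of_mem _ (⟨h0, hst⟩ : s ∈ Icc 0 t))
  rwa [div_le_iff₀ (D.phi_pos s ⟨h0, by linarith⟩)] at this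

theorem muW_eq (D : GelfandData) (α : ℝ) {r : ℝ} (hr : r ∈ Icc (0:ℝ) 1) :
    muW D α r = gMu (phiB D) α r := by
  unfold muW gMu
  congr 2
  apply intervalIntegral.integral_congr
  intro s hs
  rw [uIcc_of_le hr.1] at hs
  simp only
  rw [phiB_eq D ⟨hs.1, hs.2.trans hr.2⟩]

theorem sol_to_CSol {D : GelfandData} (hf : D.f = Real.exp) {α lam L : ℝ} {u : ℝ → ℝ}
    (C : Cl (phiB D) (psiB D) L) (S : IsSolution D α lam u) :
    CSol (phiB D) (psiB D) α lam (fun r => u (clampR r))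
      (fun r => derivWithin u (Icc 0 1) (clampR r)) := by
  obtain ⟨s1, s2, s3, s4, s5, s6⟩ := S
  have cU : Continuous (fun r => u (clampR r)) :=
    s1.continuousOn.comp_continuous clampR_cont clampR_mem
  have cV : Continuous (fun r => derivWithin u (Icc 0 1) (clampR r)) :=
    (s1.continuousOn_derivWithin (uniqueDiffOn_Icc zero_lt_one) le_rfl).comp_continuous
      clampR_cont clampR_mem
  have hloc : ∀ r ∈ Ioo (0:ℝ) 1, clampR =ᶠ[nhds r] id := by
    intro r hr
    filter_upwards [Ioo_mem_nhds hr.1 hr.2] with x hx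
    exact clampR_eq ⟨hx.1.le, hx.2.le⟩
  have dU : ∀ r ∈ Ioo (0:ℝ) 1, HasDerivAt (fun r => u (clampR r))
      (derivWithin u (Icc 0 1) (clampR r)) r := by
    intro r hr
    have hr' : r ∈ Icc (0:ℝ) 1 := ⟨hr.1.le, hr.2.le⟩
    have h1 : HasDerivAt u (derivWithin u (Icc 0 1) r) r :=
      ((s1.differentiableOn one_ne_zero r hr').hasDerivWithinAt).hasDerivAt
        (Icc_mem_nhds hr.1 hr.2)
    rw [clampR_eq hr']
    refine h1.congr_of_eventuallyEq ?_
    filter_upwards [hloc r hr] with x hx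
    rw [hx]; rfl
  have dV : ∀ r ∈ Ioo (0:ℝ) 1, HasDerivAt (fun r => derivWithin u (Icc 0 1) (clampR r))
      (derivWithin (derivWithin u (Icc 0 1)) (Ioo 0 1) r) r := by
    intro r hr
    have h0 : ContDiffOn ℝ 1 (deriv u) (Ioo 0 1) :=
      ((contDiffOn_succ_iff_deriv_of_isOpen (n := 1) isOpen_Ioo).1 s2).2.2
    have hEq : EqOn (derivWithin u (Icc 0 1)) (deriv u) (Ioo 0 1) := fun x hx =>
      derivWithin_of_mem_nhds (Icc_mem_nhds hx.1 hx.2)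
    have h1 : ContDiffOn ℝ 1 (derivWithin u (Icc 0 1)) (Ioo 0 1) := h0.congr hEq
    have h2 := ((h1.differentiableOn one_ne_zero r hr).hasDerivWithinAt).hasDerivAt
        (Ioo_mem_nhds hr.1 hr.2)
    refine h2.congr_of_eventuallyEq ?_
    filter_upwards [hloc r hr] with x hx
    rw [hx]; rfl
  refine ⟨cU, cV, dU, ?_, ?_, ?_⟩
  · intro r hr
    have hfc := flux_cont C α cU
    have cG : Continuous fun r => r * gMu (phiB D) α r * derivWithin u (Icc 0 1) (clampR r) :=
      (continuous_id.mul (gMu_cont C.cφ α)).mul cV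
    have hG : ∀ x ∈ Ioo 0 r, HasDerivAt
        (fun r => r * gMu (phiB D) α r * derivWithin u (Icc 0 1) (clampR r))
        (-(lam * (x * gMu (phiB D) α x * psiB D x * Real.exp (u (clampR x))))) x := by
      intro x hx
      have hx1 : x ∈ Ioo (0:ℝ) 1 := ⟨hx.1, hx.2.trans_le hr.2⟩
      have hx2 : x ∈ Icc (0:ℝ) 1 := ⟨hx1.1.le, hx1.2.le⟩
      have hd := (((hasDerivAt_id x).mul (gMu_deriv C.cφ α x)).mul (dV x hx1))
      refine hd.congr_deriv ?_
      have he := s6 x hx1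
      rw [hf] at he
      simp only [id, Pi.mul_apply]
      rw [clampR_eq hx2, phiB_eq D hx2, psiB_eq D hx2]
      have hx0 : x ≠ 0 := hx.1.ne'
      have he2 : x * derivWithin (derivWithin u (Icc 0 1)) (Ioo 0 1) x
          = - (1 + α * x ^ 2 * D.phi x) * derivWithin u (Icc 0 1) x
            - x * (lam * D.psi x * Real.exp (u x)) := by
        rw [← he]; field_simp; ring
      linear_combination gMu (phiB D) α x * he2
    have hH : ∀ x ∈ Ioo 0 r, HasDerivAt (fun r => -(lam * ∫ s in (0:ℝ)..r,
        s * gMu (phiB D) α s * psiB D s * Real.exp (u (clampR s))))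
        (-(lam * (x * gMu (phiB D) α x * psiB D x * Real.exp (u (clampR x))))) x := by
      intro x hx
      exact ((prim_deriv hfc x).const_mul lam).neg
    have cH : Continuous (fun r => -(lam * ∫ s in (0:ℝ)..r,
        s * gMu (phiB D) α s * psiB D s * Real.exp (u (clampR s)))) :=
      (continuous_const.mul (prim_cont hfc)).neg
    have k1 := mono_cmp hr.1 cG.continuousOn cH.continuousOn hG hH (fun _ _ => le_rfl)
    have k2 := mono_cmp hr.1 cH.continuousOn cG.continuousOn hH hG (fun _ _ => le_rfl)
    simp only [intervalIntegral.integral_same, zero_mul, mul_zero, neg_zero, sub_zero] at k1 k2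
    exact le_antisymm k1 k2
  · intro r hr
    change 0 < u (clampR r)
    rw [clampR_eq ⟨hr.1, hr.2.le⟩]
    exact s3 r hr
  · change u (clampR 1) = 0
    rw [clampR_eq (by simp)]; exact s5

theorem semi_HS {D : GelfandData} (hf : D.f = Real.exp) {α lam : ℝ} {u : ℝ → ℝ}
    (S : IsSolution D α lam u) (H : IsSemistable D α lam u) :
    ∀ η : ℝ → ℝ, ContDiff ℝ 1 η → η 1 = 0 →
      lam * ∫ r in (0:ℝ)..1, psiB D r * Real.exp (u (clampR r)) * (η r)^2 * gMu (phiB D) α r * r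
        ≤ ∫ r in (0:ℝ)..1, (deriv η r)^2 * gMu (phiB D) α r * r := by
  intro η h1 h2
  have := H η h1 h2
  rw [intervalIntegral.integral_of_le zero_le_one, intervalIntegral.integral_of_le zero_le_one,
    integral_Ioc_eq_integral_Ioo, integral_Ioc_eq_integral_Ioo]
  convert this using 1
  · congr 1
    apply setIntegral_congr_fun measurableSet_Ioo
    intro r hr
    have hr' : r ∈ Icc (0:ℝ) 1 := ⟨hr.1.le, hr.2.le⟩
    simp only
    have hu := S.2.2.1 r ⟨hr.1.le, hr.2⟩
    have hd : derivWithin D.f (Ici 0) (u r) = Real.exp (u r) := by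
      rw [hf, derivWithin_of_mem_nhds (Ici_mem_nhds hu), Real.deriv_exp]
    rw [hd, muW_eq D α hr', psiB_eq D hr', clampR_eq hr']
  · apply setIntegral_congr_fun measurableSet_Ioo
    intro r hr
    simp only
    rw [muW_eq D α ⟨hr.1.le, hr.2.le⟩]

theorem kW_cont {φ ψ : ℝ → ℝ} {L : ℝ} (C : Cl φ ψ L) (α lam : ℝ) {w : ℝ → ℝ} (hw : Continuous w) :
    Continuous (kW φ ψ α lam w) ∧ kW φ ψ α lam w 0 = 0 := by
  have hF : ∀ t, HasDerivAt (FW φ ψ α w) (hW φ ψ α w t) t := fun t =>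
    prim_deriv (flux_cont C α hw) t
  have h0 : FW φ ψ α w 0 = 0 := by simp [FW]
  have hd0 : deriv (FW φ ψ α w) 0 = 0 := by rw [(hF 0).deriv]; simp [hW]
  have hc : Continuous (dslope (FW φ ψ α w) 0) := by
    rw [continuous_iff_continuousAt]
    intro t
    by_cases ht : t = 0
    · rw [ht]; exact continuousAt_dslope_same.2 (hF 0).differentiableAt
    · exact (continuousAt_dslope_of_ne ht).2 (hF t).continuousAt
  have he : kW φ ψ α lam w = fun t => lam * dslope (FW φ ψ α w) 0 t / gMu φ α t := by
    funext t
    unfold kW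
    by_cases ht : t = 0
    · rw [ht, dslope_same, hd0, h0]; simp
    · rw [dslope_of_ne _ ht, slope_def_field, h0]
      have := (gMu_pos φ α t).ne'
      field_simp
      try ring
  constructor
  · rw [he]
    exact (continuous_const.mul hc).div (gMu_cont C.cφ α) fun t => (gMu_pos φ α t).ne'
  · simp [kW]

theorem kW_deriv {φ ψ : ℝ → ℝ} {L : ℝ} (C : Cl φ ψ L) (α lam : ℝ) {w : ℝ → ℝ} (hw : Continuous w)
    {t : ℝ} (ht : t ≠ 0) : HasDerivAt (kW φ ψ α lam w)
      (lam * ψ t * Real.exp (w t) - (1 / t + α * t * φ t) * kW φ ψ α lam w t) t := by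
  have hF : HasDerivAt (FW φ ψ α w) (hW φ ψ α w t) t := prim_deriv (flux_cont C α hw) t
  have hm := (gMu_pos φ α t).ne'
  have h := (hF.const_mul lam).div ((hasDerivAt_id t).mul (gMu_deriv C.cφ α t))
    (mul_ne_zero ht hm)
  refine h.congr_deriv ?_
  simp only [id, Pi.mul_apply]
  unfold kW hW
  field_simp

theorem exists_sol {D : GelfandData} (hf : D.f = Real.exp) {α lam L : ℝ} {w : ℝ → ℝ}
    (C : Cl (phiB D) (psiB D) L) (hl : 0 < lam) (hw : Continuous w)
    (hfix : ∀ r, w r = TW (phiB D) (psiB D) α lam w r) : ∃ u, IsSolution D α lam u := by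
  set k := kW (phiB D) (psiB D) α lam w with hk
  obtain ⟨kc, k0⟩ := kW_cont C α lam hw
  rw [← hk] at kc k0
  let u : ℝ → ℝ := fun r => (∫ t in (0:ℝ)..1, k t) - ∫ t in (0:ℝ)..r, k t
  have huI : ∀ r, u r = ∫ t in r..1, k t := fun r =>
    intervalIntegral.integral_interval_sub_left (kc.intervalIntegrable _ _)
      (kc.intervalIntegrable _ _)
  have huw : ∀ r ∈ Icc (0:ℝ) 1, u r = w r := by
    intro r hr
    rw [huI, hfix r]; unfold TW; rw [clampR_eq hr]
  have hdu : ∀ r, HasDerivAt u (-k r) r := fun r => by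
    have := (prim_deriv kc r).const_sub (∫ t in (0:ℝ)..1, k t)
    exact this
  have hderiv : deriv u = fun r => -k r := funext fun r => (hdu r).deriv
  have hdk : ∀ t ∈ Ioo (0:ℝ) 1, HasDerivAt k
      (lam * psiB D t * Real.exp (w t) - (1 / t + α * t * phiB D t) * k t) t :=
    fun t ht => kW_deriv C α lam hw ht.1.ne'
  have hC1 : ContDiff ℝ 1 u := by
    rw [contDiff_one_iff_deriv]
    refine ⟨fun r => (hdu r).differentiableAt, ?_⟩
    rw [hderiv]; exact kc.neg
  have hdw : ∀ r ∈ Icc (0:ℝ) 1, derivWithin u (Icc 0 1) r = -k r := fun r hr =>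
    (hdu r).hasDerivWithinAt.derivWithin (uniqueDiffOn_Icc zero_lt_one r hr)
  have kpos : ∀ t ∈ Ioo (0:ℝ) 1, 0 < k t := by
    intro t ht
    have hF : 0 < FW (phiB D) (psiB D) α w t := by
      have hcont := flux_cont C α hw
      apply intervalIntegral.integral_pos ht.1 hcont.continuousOn
      · intro s hs; exact hW_nonneg C hs.1.le
      · have hL := C.hL
        have ha : 0 < 1 / (2 * L) := by positivity
        refine ⟨min t (1 / (2 * L)), ⟨(lt_min ht.1 ha).le, min_le_left _ _⟩, ?_⟩
        set s := min t (1 / (2 * L))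
        have hs0 : 0 < s := lt_min ht.1 ha
        have hs1 : s ≤ 1 / (2 * L) := min_le_right _ _
        have hs2 : s ≤ t := min_le_left _ _
        have hp := C.ψL s ⟨hs0.le, hs2.trans ht.2.le⟩
        have h3 : L * s ≤ 1 / 2 := by
          calc L * s ≤ L * (1 / (2 * L)) := by gcongr
            _ = 1 / 2 := by field_simp
        have h4 : 0 < psiB D s := by linarith
        have h5 := gMu_pos (phiB D) α s
        positivity
    have h5 := gMu_pos (phiB D) α t
    have h6 := ht.1
    rw [hk]; unfold kW; positivity
  refine ⟨u, hC1.contDiffOn, ?_, ?_, ?_, ?_, ?_⟩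
  · have : ContDiffOn ℝ (1 + 1) u (Ioo 0 1) := by
      rw [contDiffOn_succ_iff_deriv_of_isOpen isOpen_Ioo]
      refine ⟨hC1.contDiffOn.differentiableOn one_ne_zero, by simp, ?_⟩
      rw [hderiv]
      apply ContDiffOn.neg
      have : ContDiffOn ℝ (0 + 1) k (Ioo 0 1) := by
        rw [contDiffOn_succ_iff_deriv_of_isOpen isOpen_Ioo]
        refine ⟨fun t ht => (hdk t ht).differentiableAt.differentiableWithinAt, by simp, ?_⟩
        rw [contDiffOn_zero]
        have hcc : ContinuousOn (fun t => lam * psiB D t * Real.exp (w t)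
            - (1 / t + α * t * phiB D t) * k t) (Ioo 0 1) := by
          have h1 := C.cφ
          have h2 := C.cψ
          refine ContinuousOn.sub (by fun_prop) (ContinuousOn.mul (ContinuousOn.add ?_ ?_) kc.continuousOn)
          · exact continuousOn_const.div continuousOn_id fun t ht => ht.1.ne'
          · fun_prop
        exact hcc.congr fun t ht => (hdk t ht).deriv
      simpa using this
    have h2 : (1 + 1 : WithTop ℕ∞) = 2 := by norm_num
    rwa [h2] at this
  · intro r hr
    rw [huI]
    apply intervalIntegral.intervalIntegral_pos_of_pos_on (kc.intervalIntegrable _ _) _ hr.2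
    intro t ht
    exact kpos t ⟨hr.1.trans_lt ht.1, ht.2⟩
  · rw [hdw 0 (by simp), k0, neg_zero]
  · rw [huI]; simp
  · intro r hr
    have hr' : r ∈ Icc (0:ℝ) 1 := ⟨hr.1.le, hr.2.le⟩
    have h1 : derivWithin (derivWithin u (Icc 0 1)) (Ioo 0 1) r
        = -(lam * psiB D r * Real.exp (w r) - (1 / r + α * r * phiB D r) * k r) := by
      rw [derivWithin_congr (f := fun r => -k r) (fun x hx => hdw x ⟨hx.1.le, hx.2.le⟩) (hdw r hr')]
      exact (hdk r hr).neg.hasDerivWithinAt.derivWithin (isOpen_Ioo.uniqueDiffWithinAt hr)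
    rw [h1, hdw r hr', hf, huw r hr', phiB_eq D hr', psiB_eq D hr']
    ring

theorem gZ_bounds {L α s : ℝ} (hL : 1 ≤ L) (hα : 1 ≤ α) (hs : Real.log α = s ^ 2)
    (hs2 : 4 * Real.log (2 * L) ≤ s ^ 2) :
    s ^ 2 / 4 ≤ gZ L α (1 / (2 * L)) ∧ gZ L α (1 / (2 * L)) ≤ s ^ 2 / 2 + 5 / 2 := by
  have hα0 : 0 < α := by linarith
  have hd : 0 < 1 / (2 * L) := by positivity
  have hd1 : 1 / (2 * L) ≤ 1 := by rw [div_le_one (by linarith)]; linarith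
  have e1 : 2 * L * |1 / (2 * L)| = 1 := by rw [abs_of_pos hd]; field_simp
  have e2 : Real.log (α * (1 / (2 * L)) ^ 2) = s ^ 2 - 2 * Real.log (2 * L) := by
    rw [Real.log_mul hα0.ne' (by positivity), Real.log_pow, one_div, Real.log_inv, hs]
    push_cast; ring
  have p : 0 < α * (1 / (2 * L)) ^ 2 := by positivity
  have e3 : Real.log (α * (1 / (2 * L)) ^ 2) ≤ Real.log (1 + α * (1 / (2 * L)) ^ 2) :=
    Real.log_le_log p (by linarith)
  have e4 : Real.log (1 + α * (1 / (2 * L)) ^ 2) ≤ s ^ 2 + 1 := by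
    have h1 : (1 / (2 * L)) ^ 2 ≤ 1 := pow_le_one₀ hd.le hd1
    have h2 : 1 + α * (1 / (2 * L)) ^ 2 ≤ 2 * α := by nlinarith
    have h3 := Real.log_le_log (by linarith) h2
    rw [Real.log_mul (by norm_num) hα0.ne', hs] at h3
    have := Real.log_two_lt_d9
    linarith
  have e5 : 0 ≤ α * (1 / (2 * L)) ^ 2 / (1 + α * (1 / (2 * L)) ^ 2) := by positivity
  have e6 : α * (1 / (2 * L)) ^ 2 / (1 + α * (1 / (2 * L)) ^ 2) ≤ 1 := by
    rw [div_le_one (by linarith)]; linarith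
  unfold gZ
  rw [e1]
  constructor <;> linarith

theorem prod3 {a b c : ℝ} (ha : 0 ≤ a) (hb : 0 ≤ b) (hc : 0 ≤ c) (h : a + b + c ≤ 1) :
    1 - (a + b + c) ≤ (1 - a) * (1 - b) * (1 - c) := by
  have h1 : 1 - (a + b) ≤ (1 - a) * (1 - b) := by nlinarith [mul_nonneg ha hb]
  have h2 : (1 - (a + b)) * (1 - c) ≤ (1 - a) * (1 - b) * (1 - c) := by
    apply mul_le_mul_of_nonneg_right h1; linarith
  nlinarith [mul_nonneg (add_nonneg ha hb) hc]

theorem exists_lower {D : GelfandData} (hf : D.f = Real.exp) {α L s m : ℝ}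
    (C : Cl (phiB D) (psiB D) L) (hm : m = ∫ t in (0:ℝ)..1, D.M t) (hα : 1 ≤ α)
    (hs : Real.log α = s ^ 2) (hs2 : 4 * Real.log (2 * L) ≤ s ^ 2) (hm0 : 0 ≤ m)
    (hs3 : 2 * ((64 * L * m + 1) + 4 * (2 * L + 2) ^ 2 + 5) ≤ s) :
    ∃ lam ∈ solvableSet D α,
      1 - ((64 * L * m + 1) + 4 * (2 * L + 2) ^ 2 + 5) / s ≤ lam * s ^ 2 / (2 * α) := by
  have hL := C.hL
  have hα0 : 0 < α := by linarith
  obtain ⟨g1, g2⟩ := gZ_bounds hL hα hs hs2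
  set G := gZ L α (1 / (2 * L)) with hG
  set A := (2 * L + 2) ^ 2 with hA
  have hA0 : 0 < A := by positivity
  have hLm : 0 ≤ L * m := by positivity
  have hs1 : 1 ≤ s := by linarith
  have hs0 : 0 < s := by linarith
  have hss : s ≤ s ^ 2 := by nlinarith
  have hG0 : 0 < G := by nlinarith
  set w1 := 64 * L * m / s ^ 2 with hw1
  have w0 : 0 ≤ w1 := by rw [hw1]; positivity
  have ws : w1 ≤ 64 * L * m / s := by
    rw [hw1]; apply div_le_div_of_nonneg_left _ hs0 hss; linarith
  set a := (64 * L * m + 1) / s with ha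
  set b := 4 * A / s with hb
  set c := 5 / s with hc
  have a0 : 0 ≤ a := by rw [ha]; apply div_nonneg <;> linarith
  have b0 : 0 ≤ b := by positivity
  have c0 : 0 ≤ c := by positivity
  have habc : a + b + c = ((64 * L * m + 1) + 4 * A + 5) / s := by
    rw [ha, hb, hc]; ring
  have habc2 : a + b + c ≤ 1 / 2 := by
    rw [habc, div_le_iff₀ hs0]; linarith
  have haw : w1 + 1 / s ≤ a := by
    rw [ha, add_div]; linarith
  have hε : 0 < 1 / s := by positivity
  set q := 1 - w1 - 1 / s with hq
  have q1 : 1 - a ≤ q := by linarith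
  have q0 : 0 < q := by linarith
  have q2 : q ≤ 1 := by linarith
  set κ := α * q / G with hκ
  have κ0 : 0 < κ := by positivity
  have hκα : κ / α = q / G := by rw [hκ]; field_simp
  have hκ4 : κ / α ≤ 4 / s ^ 2 := by
    rw [hκα, div_le_div_iff₀ hG0 (by positivity)]
    nlinarith
  have hX : κ ^ 2 * A / (α * (1 / s)) ≤ κ * b := by
    have : κ ^ 2 * A / (α * (1 / s)) = κ * (κ / α * (A * s)) := by field_simp
    rw [this]
    apply mul_le_mul_of_nonneg_left _ κ0.le
    calc κ / α * (A * s) ≤ 4 / s ^ 2 * (A * s) := by gcongr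
      _ = b := by rw [hb]; field_simp
  set lam := κ - κ ^ 2 * A / (α * (1 / s)) with hlam
  have hX0 : 0 ≤ κ ^ 2 * A / (α * (1 / s)) := by positivity
  have hlb : κ * (1 - b) ≤ lam := by rw [hlam]; linarith
  have hl0 : 0 < lam := lt_of_lt_of_le (mul_pos κ0 (by linarith)) hlb
  obtain ⟨W, B, k1, k2, k3, k4⟩ := superW_core (M := D.M) (lam := lam) (κ := κ) (ε := 1 / s)
    (w1 := w1) C (M_one D) D.M_int (M_psi D) hα hε κ0 hl0 (by linarith) w0 (by linarith)
    (by rw [hκα, ← hG, div_mul_cancel₀ _ hG0.ne']; linarith) le_rfl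
    (by
      rw [← hm]
      calc 16 * L * κ / α * m = 16 * (L * m) * (κ / α) := by ring
        _ ≤ 16 * (L * m) * (4 / s ^ 2) := by gcongr
        _ = w1 := by rw [hw1]; ring)
  obtain ⟨w, c1, c2⟩ := exists_fixed C hα0.le hl0.le k1 k2 k3 k4
  refine ⟨lam, ⟨hl0, exists_sol hf C hl0 c1 c2⟩, ?_⟩
  have hGs : 1 - c ≤ s ^ 2 / (2 * G) := by
    have h1 : 1 - c ≤ s ^ 2 / (s ^ 2 + 5) := by
      rw [le_div_iff₀ (by positivity), hc]
      have : 5 ≤ 5 / s * s ^ 2 := by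
        have : 5 / s * s ^ 2 = 5 * s := by field_simp
        linarith
      have h5 : 0 ≤ 5 / s := c0
      nlinarith
    refine h1.trans ?_
    apply div_le_div_of_nonneg_left (by positivity) (by positivity) (by linarith)
  rw [← habc]
  calc 1 - (a + b + c) ≤ (1 - a) * (1 - b) * (1 - c) := prod3 a0 b0 c0 (by linarith)
    _ ≤ q * (1 - b) * (s ^ 2 / (2 * G)) := by
      have : 0 ≤ 1 - b := by linarith
      have : 0 ≤ 1 - c := by linarith
      gcongr
    _ = κ * (1 - b) * s ^ 2 / (2 * α) := by rw [hκ]; field_simp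
    _ ≤ _ := by gcongr

theorem upper_lam {D : GelfandData} (hf : D.f = Real.exp) {α L s : ℝ}
    (C : Cl (phiB D) (psiB D) L) (hα : 0 < α) (hs : Real.log α = s ^ 2) (hs1 : 1 ≤ s)
    (hs2 : 2 * (2 * Real.log (4 * L) + 1) ≤ s) {lam : ℝ} (h : lam ∈ solvableSet D α) :
    lam * s ^ 2 / (2 * α) ≤ 1 + 2 * (2 * Real.log (4 * L) + 1) / s := by
  obtain ⟨hl, u, S⟩ := h
  have h1 := (sol_to_CSol hf C S).estA C hα hl.le
  have h2 := Real.exp_pos (-u (clampR 0))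
  have hL := C.hL
  have h3 : 0 ≤ Real.log (4 * L) := Real.log_nonneg (by linarith)
  set c := 2 * Real.log (4 * L) + 1
  have c0 : 0 ≤ c := by positivity
  rw [hs] at h1
  have h4 : lam * s ^ 2 / (2 * α) = lam / (2 * α) * s ^ 2 := by ring
  rw [h4]
  set x := lam / (2 * α)
  have x0 : 0 ≤ x := by positivity
  have hss : s ≤ s ^ 2 := by nlinarith
  have h5 : x * (s ^ 2 / 2) ≤ 1 := by
    have : x * (s ^ 2 / 2) ≤ x * (s ^ 2 - c) := by gcongr; linarith
    linarith
  have h6 : x * c ≤ 2 * c / s := by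
    rw [le_div_iff₀ (by linarith)]
    have : x * s ≤ x * s ^ 2 := by gcongr
    nlinarith
  linarith

end

/-- For the exponential nonlinearity `f(u) = e^u` (so `K = 1`):
there are `c > 0` and `α₀` such that for `α ≥ α₀`,
`|λ*(α) log α/(2α) - 1| ≤ c/√(log α)`, and every semistable solution `u` of
`(P_{α,λ*(α)})` satisfies `(1/2) log log α - c ≤ u(0) ≤ c log log α`. -/
theorem exponential_case (D : GelfandData) (hf : D.f = Real.exp) :
    ∃ c > (0:ℝ), ∃ α₀ : ℝ, ∀ α ≥ α₀,
      |lamStar D α * Real.log α / (2 * α) - 1| ≤ c / Real.sqrt (Real.log α) ∧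
      ∀ u : ℝ → ℝ, IsSolution D α (lamStar D α) u →
        IsSemistable D α (lamStar D α) u →
        (1/2) * Real.log (Real.log α) - c ≤ u 0 ∧
          u 0 ≤ c * Real.log (Real.log α) := by
  obtain ⟨L, C⟩ := exists_Cl D
  have hL := C.hL
  obtain ⟨m, hm⟩ : ∃ m, m = ∫ t in (0:ℝ)..1, D.M t := ⟨_, rfl⟩
  have hm0 : 0 ≤ m := by
    rw [hm, intervalIntegral.integral_of_le zero_le_one, integral_Ioc_eq_integral_Ioo]
    apply setIntegral_nonneg measurableSet_Ioo
    intro t ht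
    have := M_one D t ⟨ht.1.le, ht.2⟩
    linarith
  obtain ⟨C3, hC3⟩ : ∃ x, x = (64 * L * m + 1) + 4 * (2 * L + 2) ^ 2 + 5 := ⟨_, rfl⟩
  obtain ⟨C0, hC0⟩ : ∃ x, x = 2 * Real.log (4 * L) + 1 := ⟨_, rfl⟩
  have l1 : 0 ≤ Real.log (4 * L) := Real.log_nonneg (by linarith)
  have l2 : 0 ≤ Real.log (2 * L) := Real.log_nonneg (by linarith)
  have l3 : 0 ≤ Real.log L := Real.log_nonneg (by linarith)
  have C0p : 1 ≤ C0 := by linarith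
  have C3p : 5 ≤ C3 := by
    have : 0 ≤ 64 * L * m := by positivity
    have : 0 ≤ (2 * L + 2) ^ 2 := by positivity
    linarith
  obtain ⟨S, hS⟩ : ∃ x, x = 2 * C3 + 2 * C0 + 4 * Real.log (2 * L) + 2 * Real.log L + 3 := ⟨_, rfl⟩
  refine ⟨C3 + 2 * C0 + 521, by linarith, Real.exp (S ^ 2), ?_⟩
  intro α hα
  have hα0 : 0 < α := lt_of_lt_of_le (Real.exp_pos _) hα
  have hα1 : 1 ≤ α := le_trans (Real.one_le_exp (by positivity)) hα
  have hlog : S ^ 2 ≤ Real.log α := by rwa [Real.le_log_iff_exp_le hα0]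
  have hlog0 : 0 ≤ Real.log α := le_trans (by positivity) hlog
  obtain ⟨s, hs⟩ : ∃ s, s = Real.sqrt (Real.log α) := ⟨_, rfl⟩
  have hs2 : Real.log α = s ^ 2 := by rw [hs, Real.sq_sqrt hlog0]
  have hSs : S ≤ s := by rw [hs]; exact Real.le_sqrt_of_sq_le hlog
  have hs3 : 3 ≤ s := by linarith
  have hs0 : 0 < s := by linarith
  have hss : s ≤ s ^ 2 := by nlinarith
  obtain ⟨lam, hlam, hlow⟩ := exists_lower hf C hm hα1 hs2 (by linarith) hm0
    (by rw [← hC3]; linarith)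
  rw [← hC3] at hlow
  have hup : ∀ x ∈ solvableSet D α, x * s ^ 2 / (2 * α) ≤ 1 + 2 * C0 / s := fun x hx => by
    have := upper_lam hf C hα0 hs2 (by linarith) (by rw [← hC0]; linarith) hx
    rwa [← hC0] at this
  have hup2 : ∀ x ∈ solvableSet D α, x ≤ (1 + 2 * C0 / s) * (2 * α) / s ^ 2 := fun x hx => by
    have := hup x hx
    rw [div_le_iff₀ (by positivity)] at this
    rwa [le_div_iff₀ (by positivity)]
  have hge : lam ≤ lamStar D α := le_csSup ⟨_, hup2⟩ hlam
  have hle : lamStar D α ≤ (1 + 2 * C0 / s) * (2 * α) / s ^ 2 := csSup_le ⟨lam, hlam⟩ hup2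
  have hle' : lamStar D α * s ^ 2 / (2 * α) ≤ 1 + 2 * C0 / s := by
    rw [le_div_iff₀ (by positivity)] at hle
    rwa [div_le_iff₀ (by positivity)]
  have hge' : 1 - C3 / s ≤ lamStar D α * s ^ 2 / (2 * α) := by
    refine hlow.trans ?_
    gcongr
  have hpos : 0 < lamStar D α := lt_of_lt_of_le hlam.1 hge
  obtain ⟨Λ, hΛ⟩ : ∃ x, x = lamStar D α := ⟨_, rfl⟩
  rw [← hΛ] at hge' hle' hpos ⊢
  rw [← hs, hs2]
  have hX : Λ * s ^ 2 / (2 * α) = Λ / (2 * α) * s ^ 2 := by ring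
  have hdiv : ∀ a b : ℝ, a ≤ b → a / s ≤ b / s := fun a b h => by gcongr
  constructor
  · rw [abs_le]
    have h1 := hdiv C3 (C3 + 2 * C0 + 521) (by linarith)
    have h2 := hdiv (2 * C0) (C3 + 2 * C0 + 521) (by linarith)
    constructor <;> linarith
  intro u hu hsemi
  have cs := sol_to_CSol hf C hu
  have A1 := cs.estA C hα0 hpos.le
  have hLα : L ^ 2 ≤ α := by
    rw [← Real.log_le_log_iff (by positivity) hα0, Real.log_pow, hs2]
    push_cast
    linarith
  have A2 := cs.estD C hLα hpos (semi_HS hf hu hsemi)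
  have c0 : clampR 0 = 0 := clampR_eq (by simp)
  simp only [c0] at A1 A2
  rw [hs2, ← hC0] at A1
  have hlogs : Real.log (s ^ 2) = 2 * Real.log s := by rw [Real.log_pow]; push_cast; ring
  constructor
  · have h1 : C3 / s + 2 * C0 / s = (C3 + 2 * C0) / s := by ring
    have h2 : Λ / (2 * α) * C0 ≤ 2 * C0 / s := by
      have h3 : Λ / (2 * α) * s ^ 2 ≤ 2 := by
        have : 2 * C0 / s ≤ 1 := by rw [div_le_one hs0]; linarith
        linarith
      have h4 : Λ / (2 * α) * s ≤ 2 := le_trans (by gcongr) h3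
      rw [le_div_iff₀ hs0]
      nlinarith
    have h5 : Real.exp (-u 0) ≤ (C3 + 2 * C0) / s := by
      rw [← h1]; linarith
    have h6 := Real.log_le_log (Real.exp_pos _) h5
    rw [Real.log_exp, Real.log_div (by linarith) hs0.ne'] at h6
    have h7 := Real.log_le_sub_one_of_pos (show 0 < C3 + 2 * C0 by linarith)
    rw [hlogs]
    linarith
  · have h1 : C3 / s ≤ 1 / 2 := by rw [div_le_iff₀ hs0]; linarith
    have h2 : 512 * α / Λ ≤ 512 * s ^ 2 := by
      rw [div_le_iff₀ hpos]
      have h3 : 1 / 2 ≤ Λ * s ^ 2 / (2 * α) := by linarith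
      rw [le_div_iff₀ (by positivity)] at h3
      linarith
    have h4 := Real.log_le_log (by positivity) h2
    rw [Real.log_mul (by norm_num) (by positivity)] at h4
    have h5 := Real.log_le_sub_one_of_pos (show (0:ℝ) < 512 by norm_num)
    have h6 : 1 ≤ Real.log (s ^ 2) := by
      rw [Real.le_log_iff_exp_le (by positivity)]
      have := Real.exp_one_lt_d9
      linarith
    have h7 : 0 ≤ (C3 + 2 * C0) * Real.log (s ^ 2) := by
      apply mul_nonneg <;> linarith
    linarith
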